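/- arXiv:2505.13184 — 5 statements merged into one kernel-verified Lean document; each statement's English description precedes it below -/
import Mathlib

section
/- Let ρ be a probability measure on ℝ × ℝ with ρ(ℝ × (−∞,0)) = 0 (almost surely nonnegative momentum). Then for every integer M ≥ 1 and all times t₁ < t₂ < ⋯ < t_{2M}, the total classical backflow Δ := Σ_{j=1}^{M} [ ρ(τ_{t_{2j}}⁻¹((−∞,0)×ℝ)) − ρ(τ_{t_{2j−1}}⁻¹((−∞,0)×ℝ)) ] satisfies −1 ≤ Δ ≤ 0. -/
open MeasureTheory

/-- The probability of the left half-line is antitone in time when the momentum is almost surely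
nonnegative. -/
theorem antitone_measureReal_preimage_freeFlow (ρ : Measure (ℝ × ℝ)) [IsFiniteMeasure ρ]
    (hρ : ρ (Set.univ ×ˢ Set.Iio (0:ℝ)) = 0) :
    Antitone fun s : ℝ => (ρ ((fun xp : ℝ × ℝ => (xp.1 + 2 * xp.2 * s, xp.2)) ⁻¹'
      (Set.Iio (0:ℝ) ×ˢ Set.univ))).toReal := by
  intro s s' hs
  refine ENNReal.toReal_mono (measure_ne_top _ _) (measure_mono_ae ?_)
  have hp : ∀ᵐ xp ∂ρ, 0 ≤ xp.2 := by
    rw [ae_iff]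
    convert hρ using 2
    ext xp
    simp
  filter_upwards [hp] with xp hxp h
  have hx : xp.1 + 2 * xp.2 * s' < 0 := h.1
  have hle : 2 * xp.2 * s ≤ 2 * xp.2 * s' := by gcongr
  exact ⟨show xp.1 + 2 * xp.2 * s < 0 by linarith, trivial⟩

theorem Antitone.sum_range_odd_sub_even_nonpos {a : ℕ → ℝ} (ha : Antitone a) (n : ℕ) :
    ∑ j ∈ Finset.range n, (a (2 * j + 1) - a (2 * j)) ≤ 0 :=
  Finset.sum_nonpos fun j _ => sub_nonpos.2 (ha (Nat.le_succ (2 * j)))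

theorem Antitone.sub_le_sum_range_odd_sub_even {a : ℕ → ℝ} (ha : Antitone a) (n : ℕ) :
    a (2 * n) - a 0 ≤ ∑ j ∈ Finset.range n, (a (2 * j + 1) - a (2 * j)) := by
  induction n with
  | zero => simp
  | succ n ih =>
    rw [Finset.sum_range_succ]
    have h : a (2 * (n + 1)) ≤ a (2 * n + 1) := ha (Nat.le_succ (2 * n + 1))
    linarith

/-- Let `ρ` be a probability measure on phase space `ℝ × ℝ` (position ×
momentum) giving zero measure to `ℝ × (−∞,0)` (almost surely nonnegative momentum). The free
Hamiltonian flow of a classical particle of mass `1/2` is `τ_t(x,p) = (x + 2pt, p)`, and the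
probability of finding the particle on the left half-line at time `t` is
`ρ(τ_t⁻¹((−∞,0)×ℝ))`. Then for every `M ≥ 1` and all times `t₁ < t₂ < ⋯ < t_{2M}`, the total
classical backflow `Δ = Σ_{j=1}^M [ρ(τ_{t_{2j}}⁻¹((−∞,0)×ℝ)) − ρ(τ_{t_{2j−1}}⁻¹((−∞,0)×ℝ))]`
satisfies `−1 ≤ Δ ≤ 0`. -/
theorem classical_backflow_bounds
    (ρ : Measure (ℝ × ℝ)) [IsProbabilityMeasure ρ]
    (hρ : ρ (Set.univ ×ˢ Set.Iio (0:ℝ)) = 0)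
    (M : ℕ) (hM : 1 ≤ M) (t : Fin (2*M) → ℝ) (ht : StrictMono t)
    (Δ : ℝ)
    (hΔ : Δ = ∑ j : Fin M,
      ((ρ ((fun xp : ℝ × ℝ => (xp.1 + 2 * xp.2 * t ⟨2*j.1 + 1, by have := j.isLt; omega⟩,
              xp.2)) ⁻¹' (Set.Iio (0:ℝ) ×ˢ Set.univ))).toReal
        - (ρ ((fun xp : ℝ × ℝ => (xp.1 + 2 * xp.2 * t ⟨2*j.1, by have := j.isLt; omega⟩,
              xp.2)) ⁻¹' (Set.Iio (0:ℝ) ×ˢ Set.univ))).toReal)) :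
    -1 ≤ Δ ∧ Δ ≤ 0 := by
  set f : ℝ → ℝ := fun s => (ρ ((fun xp : ℝ × ℝ => (xp.1 + 2 * xp.2 * s, xp.2)) ⁻¹'
    (Set.Iio (0:ℝ) ×ˢ Set.univ))).toReal with hf
  have hanti : Antitone f := antitone_measureReal_preimage_freeFlow ρ hρ
  have hf0 (s : ℝ) : 0 ≤ f s := ENNReal.toReal_nonneg
  have hf1 (s : ℝ) : f s ≤ 1 := measureReal_le_one
  let a : ℕ → ℝ := fun n => if h : n < 2 * M then f (t ⟨n, h⟩) else 0
  have ha : Antitone a := by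
    intro m n hmn
    by_cases hn : n < 2 * M
    · have hm : m < 2 * M := hmn.trans_lt hn
      simpa only [a, dif_pos hn, dif_pos hm] using hanti (ht.monotone (Fin.mk_le_mk.2 hmn))
    · simp only [a, dif_neg hn]
      split_ifs
      exacts [hf0 _, le_rfl]
  have hsum : Δ = ∑ j ∈ Finset.range M, (a (2 * j + 1) - a (2 * j)) := by
    rw [hΔ, ← Fin.sum_univ_eq_sum_range (fun j => a (2 * j + 1) - a (2 * j))]
    refine Finset.sum_congr rfl fun j _ => ?_
    have h0 : 2 * j.1 < 2 * M := by have := j.isLt; omega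
    have h1 : 2 * j.1 + 1 < 2 * M := by have := j.isLt; omega
    simp only [a, dif_pos h0, dif_pos h1, hf]
  have hlast : a (2 * M) = 0 := dif_neg (lt_irrefl _)
  have hfirst : a 0 ≤ 1 := by
    have h : 0 < 2 * M := by omega
    simpa only [a, dif_pos h] using hf1 _
  have hlow := ha.sub_le_sum_range_odd_sub_even M
  rw [hsum]
  exact ⟨by linarith, ha.sum_range_odd_sub_even_nonpos M⟩
end

section
/- For all real t₁ < t₂, the single backflow operator B_{⟨t₁,t₂⟩} is a bounded self-adjoint operator on L²((0,∞)) with operator norm ‖B_{⟨t₁,t₂⟩}‖ = 1. -/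
open MeasureTheory Filter

noncomputable section

namespace QB

/-- Lebesgue measure on the positive half-line. -/
abbrev μp : Measure ℝ := volume.restrict (Set.Ioi (0:ℝ))

/-- The Hilbert space `L²((0,∞))`. -/
abbrev Hp : Type := Lp ℂ 2 μp

/-- The Hilbert space `L²(ℝ)`. -/
abbrev HL : Type := Lp ℂ 2 (volume : Measure ℝ)

/-- The defining properties of the operators: `S t` is multiplication by `e^{-i k² t}`,
`R` is the isometry "extend by zero and apply the inverse Fourier–Plancherel transform"
(characterised by its isometry property together with the integral formula on
integrable elements of `L²((0,∞))`, which determine it uniquely by continuity and density),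
and `Pm` is the orthogonal projection onto functions supported in `(-∞,0)`. -/
structure Setup (S : ℝ → Hp →L[ℂ] Hp) (R : Hp →L[ℂ] HL) (Pm : HL →L[ℂ] HL) : Prop where
  hS : ∀ (t : ℝ) (φ : Hp),
    (S t φ : ℝ → ℂ) =ᵐ[μp] fun k => Complex.exp (-Complex.I * (k:ℂ)^2 * (t:ℂ)) * φ k
  hR_isometry : ∀ φ : Hp, ‖R φ‖ = ‖φ‖
  hR : ∀ φ : Hp, Integrable (φ : ℝ → ℂ) μp →
    (R φ : ℝ → ℂ) =ᵐ[volume]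
      fun x => (((2 * Real.pi) ^ (-(1/2) : ℝ) : ℝ) : ℂ) *
        ∫ k in Set.Ioi (0:ℝ), Complex.exp (Complex.I * (x:ℂ) * (k:ℂ)) * φ k
  hPm : ∀ ψ : HL, (Pm ψ : ℝ → ℂ) =ᵐ[volume] Set.indicator (Set.Iio (0:ℝ)) (fun x => ψ x)

/-- The single backflow operator `B_{⟨t₁,t₂⟩} = S_{t₂}* R* Π⁻ R S_{t₂} − S_{t₁}* R* Π⁻ R S_{t₁}`. -/
def B1 (S : ℝ → Hp →L[ℂ] Hp) (R : Hp →L[ℂ] HL) (Pm : HL →L[ℂ] HL) (t₁ t₂ : ℝ) :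
    Hp →L[ℂ] Hp :=
  (ContinuousLinearMap.adjoint (S t₂)).comp ((ContinuousLinearMap.adjoint R).comp
    (Pm.comp (R.comp (S t₂))))
  - (ContinuousLinearMap.adjoint (S t₁)).comp ((ContinuousLinearMap.adjoint R).comp
    (Pm.comp (R.comp (S t₁))))

/-- The `M`-fold backflow operator `B^{(M)}_t = Σ_{j=1}^M B_{⟨t_{2j-1}, t_{2j}⟩}`
(zero-based indexing of the tuple `t`). -/
def BM (S : ℝ → Hp →L[ℂ] Hp) (R : Hp →L[ℂ] HL) (Pm : HL →L[ℂ] HL) (M : ℕ)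
    (t : Fin (2*M) → ℝ) : Hp →L[ℂ] Hp :=
  ∑ j : Fin M, B1 S R Pm (t ⟨2*j.1, by have := j.isLt; omega⟩)
    (t ⟨2*j.1+1, by have := j.isLt; omega⟩)

/-- `𝒯_M`: the set of strictly increasing `2M`-tuples of reals. -/
def TM (M : ℕ) : Set (Fin (2*M) → ℝ) := {t | StrictMono t}

section Projection

variable {S : ℝ → Hp →L[ℂ] Hp} {R : Hp →L[ℂ] HL} {Pm : HL →L[ℂ] HL}

theorem Setup.norm_S (h : Setup S R Pm) (t : ℝ) (φ : Hp) : ‖S t φ‖ = ‖φ‖ := by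
  have key : ∀ᵐ k ∂μp, ‖(S t φ : ℝ → ℂ) k‖ = ‖(φ : ℝ → ℂ) k‖ := by
    filter_upwards [h.hS t φ] with k hk
    have : -Complex.I * (k:ℂ)^2 * (t:ℂ) = ((-(k^2*t) : ℝ) : ℂ) * Complex.I := by
      push_cast; ring
    rw [hk, norm_mul, this, Complex.norm_exp_ofReal_mul_I, one_mul]
  exact le_antisymm (Lp.norm_le_norm_of_ae_le (key.mono fun _ h => h.le))
    (Lp.norm_le_norm_of_ae_le (key.mono fun _ h => h.ge))

theorem Setup.norm_two_smul_Pm_sub (h : Setup S R Pm) (ψ : HL) :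
    ‖(2:ℂ) • Pm ψ - ψ‖ ≤ ‖ψ‖ := by
  refine Lp.norm_le_norm_of_ae_le ?_
  filter_upwards [h.hPm ψ, Lp.coeFn_sub ((2:ℂ) • Pm ψ) ψ, Lp.coeFn_smul (2:ℂ) (Pm ψ)]
    with x h1 h2 h3
  rw [h2, Pi.sub_apply, h3, Pi.smul_apply, h1]
  by_cases hx : x ∈ Set.Iio (0:ℝ)
  · rw [Set.indicator_of_mem hx, smul_eq_mul]
    exact le_of_eq (by congr 1; ring)
  · rw [Set.indicator_of_notMem hx]; simp

theorem Setup.isSelfAdjoint_Pm (h : Setup S R Pm) : IsSelfAdjoint Pm := by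
  rw [ContinuousLinearMap.isSelfAdjoint_iff_isSymmetric]
  intro ψ χ
  change inner ℂ (Pm ψ) χ = inner ℂ ψ (Pm χ)
  rw [L2.inner_def, L2.inner_def]
  refine integral_congr_ae ?_
  filter_upwards [h.hPm ψ, h.hPm χ] with x h1 h2
  rw [h1, h2]
  by_cases hx : x ∈ Set.Iio (0:ℝ)
  · rw [Set.indicator_of_mem hx, Set.indicator_of_mem hx]
  · rw [Set.indicator_of_notMem hx, Set.indicator_of_notMem hx]; simp

theorem Setup.inner_Pm_self (h : Setup S R Pm) (ψ : HL) :
    inner ℂ ψ (Pm ψ) = ((∫ x in Set.Iio (0:ℝ), ‖(ψ : ℝ → ℂ) x‖ ^ 2 : ℝ) : ℂ) := by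
  rw [L2.inner_def, ← integral_complex_ofReal, ← integral_indicator measurableSet_Iio]
  refine integral_congr_ae ?_
  filter_upwards [h.hPm ψ] with x h1
  rw [h1]
  by_cases hx : x ∈ Set.Iio (0:ℝ)
  · rw [Set.indicator_of_mem hx, Set.indicator_of_mem hx, inner_self_eq_norm_sq_to_K]
    simp
  · rw [Set.indicator_of_notMem hx, Set.indicator_of_notMem hx]; simp

theorem inner_B1 (t₁ t₂ : ℝ) (φ χ : Hp) :
    inner ℂ φ (B1 S R Pm t₁ t₂ χ) =
      inner ℂ (R (S t₂ φ)) (Pm (R (S t₂ χ))) - inner ℂ (R (S t₁ φ)) (Pm (R (S t₁ χ))) := by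
  simp [B1, inner_sub_right, ContinuousLinearMap.adjoint_inner_right]

theorem Setup.isSelfAdjoint_B1 (h : Setup S R Pm) (t₁ t₂ : ℝ) :
    IsSelfAdjoint (B1 S R Pm t₁ t₂) := by
  have hP := h.isSelfAdjoint_Pm
  refine IsSelfAdjoint.sub ?_ ?_
  · exact (hP.adjoint_conj R).adjoint_conj (S t₂)
  · exact (hP.adjoint_conj R).adjoint_conj (S t₁)

theorem Setup.norm_B1_le (h : Setup S R Pm) (t₁ t₂ : ℝ) : ‖B1 S R Pm t₁ t₂‖ ≤ 1 := by
  have hRS : ∀ t φ, ‖R (S t φ)‖ = ‖φ‖ := fun t φ => by rw [h.hR_isometry, h.norm_S]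
  have hinner : ∀ t (φ χ : Hp), inner ℂ (R (S t φ)) (R (S t χ)) = inner ℂ φ χ := fun t =>
    (LinearMap.norm_map_iff_inner_map_map (R.comp (S t))).1 (hRS t)
  have hrefl : ∀ t (φ χ : Hp),
      ‖inner ℂ (R (S t φ)) ((2:ℂ) • Pm (R (S t χ)) - R (S t χ))‖ ≤ ‖φ‖ * ‖χ‖ := fun t φ χ => by
    refine (norm_inner_le_norm _ _).trans ?_
    rw [hRS]
    exact mul_le_mul_of_nonneg_left ((h.norm_two_smul_Pm_sub _).trans (hRS t χ).le)
      (norm_nonneg _)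
  refine ContinuousLinearMap.opNorm_le_bound _ zero_le_one fun χ => ?_
  rw [one_mul]
  set φ := B1 S R Pm t₁ t₂ χ with hφ
  have h2 : (2:ℂ) * inner ℂ φ φ =
      inner ℂ (R (S t₂ φ)) ((2:ℂ) • Pm (R (S t₂ χ)) - R (S t₂ χ))
        - inner ℂ (R (S t₁ φ)) ((2:ℂ) • Pm (R (S t₁ χ)) - R (S t₁ χ)) := by
    simp only [inner_sub_right, inner_smul_right, hinner]
    nth_rewrite 2 [hφ]
    rw [inner_B1]
    ring
  have h3 := congrArg norm h2
  rw [norm_mul, Complex.norm_two, inner_self_eq_norm_sq_to_K] at h3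
  have h4 := (norm_sub_le _ _).trans (add_le_add (hrefl t₂ φ χ) (hrefl t₁ φ χ))
  rw [← h3] at h4
  have h5 : ‖((‖φ‖ : ℂ)) ^ 2‖ = ‖φ‖ ^ 2 := by simp
  rcases (norm_nonneg φ).eq_or_lt with h0 | h0
  · rw [← h0]; exact norm_nonneg _
  · refine le_of_mul_le_mul_left ?_ h0
    have : 2 * ‖φ‖ ^ 2 ≤ ‖φ‖ * ‖χ‖ + ‖φ‖ * ‖χ‖ := by rw [← h5]; exact h4
    nlinarith

end Projection

section WavePacket

/-- The momentum-space profile `1_{(a, a+1]}(k) e^{i k² t}`. -/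
def packetFun (t a : ℝ) : ℝ → ℂ :=
  (Set.Ioc a (a + 1)).indicator fun k => Complex.exp (Complex.I * (k:ℂ)^2 * (t:ℂ))

theorem norm_exp_I_mul_sq (k t : ℝ) : ‖Complex.exp (Complex.I * (k:ℂ)^2 * (t:ℂ))‖ = 1 := by
  have : Complex.I * (k:ℂ)^2 * (t:ℂ) = ((k^2*t : ℝ) : ℂ) * Complex.I := by
    push_cast; ring
  rw [this, Complex.norm_exp_ofReal_mul_I]

theorem memLp_packetFun (t a : ℝ) (p : ENNReal) : MemLp (packetFun t a) p μp := by
  rw [packetFun, memLp_indicator_iff_restrict measurableSet_Ioc]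
  have : IsFiniteMeasure (μp.restrict (Set.Ioc a (a + 1))) :=
    ⟨by
      rw [Measure.restrict_apply_univ]
      exact (Measure.restrict_apply_le _ _).trans_lt measure_Ioc_lt_top⟩
  refine MemLp.of_bound (C := 1) ?_ (ae_of_all _ fun k => (norm_exp_I_mul_sq k t).le)
  exact Continuous.aestronglyMeasurable (by fun_prop)

/-- The wave packet with momentum profile `packetFun t a`, as an element of `L²((0,∞))`. -/
def packet (t a : ℝ) : Hp := (memLp_packetFun t a 2).toLp _

theorem coeFn_packet (t a : ℝ) : (packet t a : ℝ → ℂ) =ᵐ[μp] packetFun t a :=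
  MemLp.coeFn_toLp _

theorem norm_packet (t : ℝ) {a : ℝ} (ha : 0 ≤ a) : ‖packet t a‖ = 1 := by
  have h1 : ‖packet t a‖ ^ 2 = 1 := by
    have h2 : inner ℂ (packet t a) (packet t a) = (1:ℂ) := by
      rw [L2.inner_def]
      have : (∫ k, inner ℂ ((packet t a : ℝ → ℂ) k) ((packet t a : ℝ → ℂ) k) ∂μp)
          = ∫ k in Set.Ioi (0:ℝ), (Set.Ioc a (a+1)).indicator (fun _ => (1:ℂ)) k := by
        refine integral_congr_ae ?_
        filter_upwards [coeFn_packet t a] with k hk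
        rw [hk, packetFun, inner_self_eq_norm_sq_to_K]
        by_cases hx : k ∈ Set.Ioc a (a + 1)
        · rw [Set.indicator_of_mem hx, Set.indicator_of_mem hx, norm_exp_I_mul_sq]; simp
        · rw [Set.indicator_of_notMem hx, Set.indicator_of_notMem hx]; simp
      rw [this, setIntegral_indicator measurableSet_Ioc,
        Set.inter_eq_right.2 (Set.Ioc_subset_Ioi_self.trans (Set.Ioi_subset_Ioi ha))]
      simp
    rw [inner_self_eq_norm_sq_to_K] at h2
    simpa only [norm_pow, RCLike.norm_ofReal, abs_norm, norm_one] using congrArg norm h2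
  nlinarith [norm_nonneg (packet t a)]

/-- The position-space amplitude at time `s` of the packet with momenta in `(0, 1]`. -/
def amplitude (s x : ℝ) : ℂ :=
  (((2 * Real.pi) ^ (-(1/2) : ℝ) : ℝ) : ℂ) *
    ∫ k in (0:ℝ)..1, Complex.exp (Complex.I * (x:ℂ) * (k:ℂ)) *
      Complex.exp (-Complex.I * (k:ℂ)^2 * (s:ℂ))

variable {S : ℝ → Hp →L[ℂ] Hp} {R : Hp →L[ℂ] HL} {Pm : HL →L[ℂ] HL}

theorem Setup.S_packet (h : Setup S R Pm) (t t₀ a : ℝ) : S t (packet t₀ a) = packet (t₀ - t) a := by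
  refine Lp.ext ?_
  filter_upwards [h.hS t (packet t₀ a), coeFn_packet t₀ a, coeFn_packet (t₀ - t) a]
    with k h1 h2 h3
  rw [h1, h2, h3, packetFun, packetFun]
  by_cases hx : k ∈ Set.Ioc a (a + 1)
  · rw [Set.indicator_of_mem hx, Set.indicator_of_mem hx, ← Complex.exp_add]
    congr 1; push_cast; ring
  · rw [Set.indicator_of_notMem hx, Set.indicator_of_notMem hx, mul_zero]

/-- Shifting the momenta by `a` translates the position amplitude at time `s` by `2as`,
up to a phase. -/
theorem Setup.norm_R_packet (h : Setup S R Pm) (s : ℝ) {a : ℝ} (ha : 0 ≤ a) :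
    ∀ᵐ x : ℝ, ‖(R (packet (-s) a) : ℝ → ℂ) x‖ = ‖amplitude s (x - 2 * a * s)‖ := by
  have hint : Integrable (packet (-s) a : ℝ → ℂ) μp :=
    (memLp_one_iff_integrable.1 (memLp_packetFun (-s) a 1)).congr (coeFn_packet _ _).symm
  filter_upwards [h.hR _ hint] with x hx
  have h1 : (∫ k in Set.Ioi (0:ℝ),
        Complex.exp (Complex.I * (x:ℂ) * (k:ℂ)) * (packet (-s) a : ℝ → ℂ) k)
      = ∫ k in Set.Ioi (0:ℝ), (Set.Ioc a (a+1)).indicator (fun k : ℝ =>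
        Complex.exp (Complex.I * (x:ℂ) * (k:ℂ)) *
          Complex.exp (-Complex.I * (k:ℂ)^2 * (s:ℂ))) k := by
    refine integral_congr_ae ?_
    filter_upwards [coeFn_packet (-s) a] with k hk
    rw [hk, packetFun]
    by_cases hk : k ∈ Set.Ioc a (a + 1)
    · rw [Set.indicator_of_mem hk, Set.indicator_of_mem hk]
      congr 2; push_cast; ring
    · rw [Set.indicator_of_notMem hk, Set.indicator_of_notMem hk, mul_zero]
  have h2 : (∫ k in Set.Ioi (0:ℝ), (Set.Ioc a (a+1)).indicator (fun k : ℝ =>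
        Complex.exp (Complex.I * (x:ℂ) * (k:ℂ)) *
          Complex.exp (-Complex.I * (k:ℂ)^2 * (s:ℂ))) k)
      = Complex.exp (((x * a - a ^ 2 * s : ℝ) : ℂ) * Complex.I) *
        ∫ k in (0:ℝ)..1, Complex.exp (Complex.I * ((x - 2 * a * s : ℝ):ℂ) * (k:ℂ)) *
          Complex.exp (-Complex.I * (k:ℂ)^2 * (s:ℂ)) := by
    rw [setIntegral_indicator measurableSet_Ioc,
      Set.inter_eq_right.2 (Set.Ioc_subset_Ioi_self.trans (Set.Ioi_subset_Ioi ha)),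
      ← intervalIntegral.integral_of_le (by linarith), ← intervalIntegral.integral_const_mul]
    have := intervalIntegral.integral_comp_add_right (a := (0:ℝ)) (b := 1) (fun k : ℝ =>
        Complex.exp (Complex.I * (x:ℂ) * (k:ℂ)) *
          Complex.exp (-Complex.I * (k:ℂ)^2 * (s:ℂ))) a
    rw [zero_add, add_comm 1 a] at this
    rw [← this]
    congr 1
    funext k
    simp only [← Complex.exp_add]
    congr 1; push_cast; ring
  rw [hx, h1, h2, amplitude, norm_mul, norm_mul, norm_mul, Complex.norm_exp_ofReal_mul_I, one_mul]

theorem Setup.integrable_norm_sq_amplitude (h : Setup S R Pm) (s : ℝ) :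
    Integrable fun x => ‖amplitude s x‖ ^ 2 := by
  refine (Lp.memLp (R (packet (-s) 0))).integrable_norm_pow (by norm_num) |>.congr ?_
  filter_upwards [h.norm_R_packet s le_rfl] with x hx
  rw [hx]; simp

theorem Setup.integral_norm_sq_amplitude (h : Setup S R Pm) (s : ℝ) :
    ∫ x, ‖amplitude s x‖ ^ 2 = 1 := by
  have h1 : inner ℂ (R (packet (-s) 0)) (R (packet (-s) 0))
      = ((∫ x, ‖amplitude s x‖ ^ 2 : ℝ) : ℂ) := by
    rw [L2.inner_def, ← integral_complex_ofReal]
    refine integral_congr_ae ?_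
    filter_upwards [h.norm_R_packet s le_rfl] with x hx
    rw [inner_self_eq_norm_sq_to_K, hx]
    simp
  rw [inner_self_eq_norm_sq_to_K, h.hR_isometry, norm_packet _ le_rfl] at h1
  norm_num at h1
  exact_mod_cast h1.symm

theorem Setup.setIntegral_norm_sq_R_packet (h : Setup S R Pm) (s : ℝ) {a : ℝ} (ha : 0 ≤ a) :
    ∫ x in Set.Iio (0:ℝ), ‖(R (packet (-s) a) : ℝ → ℂ) x‖ ^ 2 =
      ∫ x in Set.Iio (-(2 * a * s)), ‖amplitude s x‖ ^ 2 := by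
  rw [← integral_indicator measurableSet_Iio, ← integral_indicator measurableSet_Iio,
    ← integral_sub_right_eq_self (Set.indicator (Set.Iio (-(2 * a * s))) _) (2 * a * s)]
  refine integral_congr_ae ?_
  filter_upwards [h.norm_R_packet s ha] with x hx
  by_cases hx0 : x < 0
  · rw [Set.indicator_of_mem (by exact hx0),
      Set.indicator_of_mem (by rw [Set.mem_Iio]; linarith), hx]
  · rw [Set.indicator_of_notMem (by exact hx0),
      Set.indicator_of_notMem (by rw [Set.mem_Iio]; linarith)]

theorem Setup.tendsto_setIntegral_atTop (h : Setup S R Pm) (s : ℝ) :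
    Tendsto (fun b => ∫ x in Set.Iio b, ‖amplitude s x‖ ^ 2) atTop (nhds 1) := by
  rw [← h.integral_norm_sq_amplitude s]
  exact (aecover_Iio tendsto_id).integral_tendsto_of_countably_generated
    (h.integrable_norm_sq_amplitude s)

theorem Setup.tendsto_setIntegral_atBot (h : Setup S R Pm) (s : ℝ) :
    Tendsto (fun b => ∫ x in Set.Iio b, ‖amplitude s x‖ ^ 2) atBot (nhds 0) := by
  have hi := h.integrable_norm_sq_amplitude s
  have h1 : Tendsto (fun b => ∫ x in Set.Ici b, ‖amplitude s x‖ ^ 2) atBot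
      (nhds (∫ x, ‖amplitude s x‖ ^ 2)) :=
    (aecover_Ici tendsto_id).integral_tendsto_of_countably_generated hi
  have h2 := (tendsto_const_nhds (x := ∫ x, ‖amplitude s x‖ ^ 2)).sub h1
  rw [sub_self] at h2
  refine h2.congr fun b => ?_
  rw [← integral_add_compl (measurableSet_Iio (a := b)) hi, Set.compl_Iio, add_sub_cancel_right]

theorem Setup.one_le_norm_B1 (h : Setup S R Pm) {t₁ t₂ : ℝ} (h12 : t₁ < t₂) :
    1 ≤ ‖B1 S R Pm t₁ t₂‖ := by
  set s := (t₂ - t₁) / 2 with hs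
  have hs0 : 0 < s := by linarith
  set t₀ := (t₁ + t₂) / 2
  have key : ∀ a : ℝ, 0 ≤ a →
      |(∫ x in Set.Iio (-(2 * a * s)), ‖amplitude s x‖ ^ 2) -
        ∫ x in Set.Iio (-(2 * a * -s)), ‖amplitude (-s) x‖ ^ 2| ≤ ‖B1 S R Pm t₁ t₂‖ := by
    intro a ha
    have h1 := (norm_inner_le_norm (𝕜 := ℂ) (packet t₀ a) (B1 S R Pm t₁ t₂ (packet t₀ a))).trans
      (mul_le_mul_of_nonneg_left ((B1 S R Pm t₁ t₂).le_opNorm _) (norm_nonneg _))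
    rw [inner_B1, h.inner_Pm_self, h.inner_Pm_self, h.S_packet, h.S_packet,
      norm_packet _ ha, show t₀ - t₂ = -s by ring, show t₀ - t₁ = - -s by ring,
      h.setIntegral_norm_sq_R_packet s ha, h.setIntegral_norm_sq_R_packet (-s) ha, one_mul,
      mul_one, ← Complex.ofReal_sub, Complex.norm_real] at h1
    exact h1
  have l1 : Tendsto (fun a : ℝ => -(2 * a * s)) atTop atBot :=
    tendsto_neg_atTop_atBot.comp
      ((tendsto_id.const_mul_atTop two_pos).atTop_mul_const hs0)
  have l2 : Tendsto (fun a : ℝ => -(2 * a * -s)) atTop atTop := by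
    simp only [mul_neg, neg_neg]
    exact (tendsto_id.const_mul_atTop two_pos).atTop_mul_const hs0
  have l3 := (((h.tendsto_setIntegral_atBot s).comp l1).sub
    ((h.tendsto_setIntegral_atTop (-s)).comp l2)).abs
  rw [zero_sub, abs_neg, abs_one] at l3
  exact le_of_tendsto l3 ((eventually_ge_atTop 0).mono key)

end WavePacket

/-- For all real `t₁ < t₂`, the single backflow operator `B_{⟨t₁,t₂⟩}` is a
bounded self-adjoint operator on `L²((0,∞))` with operator norm `‖B_{⟨t₁,t₂⟩}‖ = 1`. -/
theorem single_backflow_selfAdjoint_norm_one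
    (S : ℝ → Hp →L[ℂ] Hp) (R : Hp →L[ℂ] HL) (Pm : HL →L[ℂ] HL)
    (hSetup : Setup S R Pm) (t₁ t₂ : ℝ) (h12 : t₁ < t₂) :
    IsSelfAdjoint (B1 S R Pm t₁ t₂) ∧ ‖B1 S R Pm t₁ t₂‖ = 1 := by
  exact ⟨hSetup.isSelfAdjoint_B1 t₁ t₂,
    le_antisymm (hSetup.norm_B1_le t₁ t₂) (hSetup.one_le_norm_B1 h12)⟩

end QB
end
end

section
/- For all real t₁ < t₂: (i) for every τ ∈ ℝ, S_τ* B_{⟨t₁,t₂⟩} S_τ = B_{⟨t₁+τ, t₂+τ⟩}; (ii) for every α > 0, with the dilation unitary (D_α φ)(k) = √α · φ(αk) on L²((0,∞)), D_α* B_{⟨t₁,t₂⟩} D_α = B_{⟨t₁/α², t₂/α²⟩}; (iii) consequently, for any other pair s₁ < s₂ there exists a unitary U on L²((0,∞)) with B_{⟨s₁,s₂⟩} = U* B_{⟨t₁,t₂⟩} U, and in particular the spectra σ(B_{⟨s₁,s₂⟩}) and σ(B_{⟨t₁,t₂⟩}) coincide. -/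
open MeasureTheory Filter

noncomputable section

namespace QB

open ContinuousLinearMap

lemma quasiMeasurePreserving_mul_left_pos {α : ℝ} (hα : 0 < α) :
    Measure.QuasiMeasurePreserving (fun k : ℝ => α * k) μp μp := by
  have h : Measure.QuasiMeasurePreserving (fun k : ℝ => α * k) volume volume :=
    Measure.quasiMeasurePreserving_smul volume hα.ne'
  exact h.restrict fun k (hk : 0 < k) => mul_pos hα hk

/-- Elements of `L²((0,∞))` that are integrable form a dense set. -/
lemma dense_integrable_Hp : Dense {φ : Hp | Integrable (φ : ℝ → ℂ) μp} := by
  refine (Lp.simpleFunc.denseRange (E := ℂ) (μ := μp) (p := 2) (by simp)).mono ?_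
  rintro _ ⟨f, rfl⟩
  have h : Integrable (Lp.simpleFunc.toSimpleFunc f) μp :=
    (SimpleFunc.memLp_iff_integrable (by simp) (by simp)).1 (Lp.simpleFunc.memLp f)
  exact h.congr (Lp.simpleFunc.toSimpleFunc_eq_toFun f)

lemma mem_unitary_of_adjoint_comp_self {U V : Hp →L[ℂ] Hp}
    (h : (adjoint U).comp U = 1) (hV : U.comp V = 1) : U ∈ unitary (Hp →L[ℂ] Hp) := by
  have h' : star U * U = 1 := h
  have hV' : U * V = 1 := hV
  refine Unitary.mem_iff.2 ⟨h', ?_⟩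
  rwa [left_inv_eq_right_inv h' hV']

section Evolution

variable {S : ℝ → Hp →L[ℂ] Hp}
  (hS : ∀ (t : ℝ) (φ : Hp),
    (S t φ : ℝ → ℂ) =ᵐ[μp] fun k => Complex.exp (-Complex.I * (k:ℂ)^2 * (t:ℂ)) * φ k)

include hS

lemma evolution_comp (s t : ℝ) : (S s).comp (S t) = S (s + t) := by
  ext φ : 1
  apply Lp.ext
  filter_upwards [hS s (S t φ), hS t φ, hS (s + t) φ] with k h₁ h₂ h₃
  rw [comp_apply, h₁, h₂, h₃, ← mul_assoc, ← Complex.exp_add]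
  push_cast
  ring_nf

lemma evolution_mem_unitary (t : ℝ) : S t ∈ unitary (Hp →L[ℂ] Hp) := by
  have h0 : S 0 = 1 := by
    ext φ : 1
    apply Lp.ext
    filter_upwards [hS 0 φ] with k h
    simp [h]
  refine mem_unitary_of_adjoint_comp_self (V := S (-t)) ?_ ?_
  · refine (norm_map_iff_adjoint_comp_self (S t)).1 fun φ => ?_
    rw [Lp.norm_def, Lp.norm_def]
    congr 1
    refine eLpNorm_congr_norm_ae ?_
    filter_upwards [hS t φ] with k h
    have : -Complex.I * (k:ℂ)^2 * (t:ℂ) = ((-(k^2 * t) : ℝ) : ℂ) * Complex.I := by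
      push_cast; ring
    rw [h, norm_mul, this, Complex.norm_exp_ofReal_mul_I, one_mul]
  · rw [evolution_comp hS, add_neg_cancel, h0]

end Evolution

section Dilation

variable {α : ℝ} {T : Hp →L[ℂ] Hp}
  (hT : ∀ φ : Hp, (T φ : ℝ → ℂ) =ᵐ[μp] fun k => (Real.sqrt α : ℂ) * φ (α * k))

include hT

lemma inner_dilation (hα : 0 < α) (φ ψ : Hp) : inner ℂ (T φ) (T ψ) = inner ℂ φ ψ := by
  rw [L2.inner_def, L2.inner_def]
  have h : (fun k => inner ℂ ((T φ : ℝ → ℂ) k) ((T ψ : ℝ → ℂ) k)) =ᵐ[μp]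
      fun k => α • inner ℂ ((φ : ℝ → ℂ) (α * k)) ((ψ : ℝ → ℂ) (α * k)) := by
    filter_upwards [hT φ, hT ψ] with k h₁ h₂
    have hs : (Real.sqrt α : ℂ) * Real.sqrt α = α := by
      exact_mod_cast Real.mul_self_sqrt hα.le
    rw [h₁, h₂, Complex.real_smul, ← hs]
    simp only [RCLike.inner_apply, map_mul, Complex.conj_ofReal]
    ring
  rw [integral_congr_ae h, integral_smul]
  simpa using integral_comp_mul_left_Ioi'
    (fun k => inner ℂ ((φ : ℝ → ℂ) k) ((ψ : ℝ → ℂ) k)) 0 hα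

lemma dilation_mem_unitary (hα : 0 < α) {T' : Hp →L[ℂ] Hp}
    (hT' : ∀ φ : Hp, (T' φ : ℝ → ℂ) =ᵐ[μp] fun k => (Real.sqrt α⁻¹ : ℂ) * φ (α⁻¹ * k)) :
    T ∈ unitary (Hp →L[ℂ] Hp) := by
  refine mem_unitary_of_adjoint_comp_self (V := T') ?_ ?_
  · exact (inner_map_map_iff_adjoint_comp_self T).1 (inner_dilation hT hα)
  · ext φ : 1
    apply Lp.ext
    filter_upwards [hT (T' φ),
      (quasiMeasurePreserving_mul_left_pos hα).ae_eq_comp (hT' φ)] with k h₁ h₂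
    simp only [Function.comp_apply] at h₂
    have hs : (Real.sqrt α : ℂ) * Real.sqrt α⁻¹ = 1 := by
      rw [← Complex.ofReal_mul, ← Real.sqrt_mul hα.le, mul_inv_cancel₀ hα.ne']
      simp
    rw [comp_apply, h₁, h₂, inv_mul_cancel_left₀ hα.ne', ← mul_assoc, hs]
    simp

lemma evolution_comp_dilation {S : ℝ → Hp →L[ℂ] Hp}
    (hS : ∀ (t : ℝ) (φ : Hp),
      (S t φ : ℝ → ℂ) =ᵐ[μp] fun k => Complex.exp (-Complex.I * (k:ℂ)^2 * (t:ℂ)) * φ k)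
    (hα : 0 < α) (t : ℝ) : (S t).comp T = T.comp (S (t / α^2)) := by
  ext φ : 1
  apply Lp.ext
  filter_upwards [hS t (T φ), hT φ, hT (S (t / α^2) φ),
    (quasiMeasurePreserving_mul_left_pos hα).ae_eq_comp (hS (t / α^2) φ)] with k h₁ h₂ h₃ h₄
  simp only [Function.comp_apply] at h₄
  have he : -Complex.I * (k:ℂ)^2 * (t:ℂ)
      = -Complex.I * ((α * k : ℝ) : ℂ)^2 * ((t / α^2 : ℝ) : ℂ) := by
    have : (α : ℂ) ≠ 0 := by exact_mod_cast hα.ne'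
    push_cast
    field_simp
  rw [comp_apply, comp_apply, h₁, h₂, h₃, h₄, he]
  ring

variable {S : ℝ → Hp →L[ℂ] Hp} {R : Hp →L[ℂ] HL} {Pm : HL →L[ℂ] HL} (hSetup : Setup S R Pm)

include hSetup

/-- The inverse Fourier transform intertwines the dilation by `α` with that by `α⁻¹`. -/
lemma fourier_dilation_ae (hα : 0 < α) {φ : Hp} (hφ : Integrable (φ : ℝ → ℂ) μp) :
    (R (T φ) : ℝ → ℂ) =ᵐ[volume] fun x => (Real.sqrt α⁻¹ : ℂ) * R φ (α⁻¹ * x) := by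
  have hTφ : Integrable (T φ : ℝ → ℂ) μp := by
    refine Integrable.congr (Integrable.const_mul ?_ _) (hT φ).symm
    have := (integrableOn_Ioi_comp_mul_left_iff (φ : ℝ → ℂ) 0 hα).2
    simpa [IntegrableOn] using this (by simpa [IntegrableOn] using hφ)
  have hq : Measure.QuasiMeasurePreserving (fun x : ℝ => α⁻¹ * x) volume volume :=
    Measure.quasiMeasurePreserving_smul volume (inv_ne_zero hα.ne')
  filter_upwards [hSetup.hR _ hTφ, hq.ae_eq_comp (hSetup.hR _ hφ)] with x h₁ h₂
  simp only [Function.comp_apply] at h₂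
  rw [h₁, h₂]
  have h : ∫ k in Set.Ioi (0:ℝ), Complex.exp (Complex.I * (x:ℂ) * (k:ℂ)) * T φ k
      = ∫ k in Set.Ioi (0:ℝ), (Real.sqrt α : ℂ) *
        (Complex.exp (Complex.I * ((α⁻¹ * x : ℝ) : ℂ) * ((α * k : ℝ) : ℂ)) * φ (α * k)) := by
    refine integral_congr_ae ?_
    filter_upwards [hT φ] with k hk
    have he : Complex.I * ((α⁻¹ * x : ℝ) : ℂ) * ((α * k : ℝ) : ℂ)
        = Complex.I * (x:ℂ) * (k:ℂ) := by
      have : (α : ℂ) ≠ 0 := by exact_mod_cast hα.ne'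
      push_cast
      field_simp
    rw [hk, he]
    ring
  have hs : (Real.sqrt α : ℂ) * ((α⁻¹ : ℝ) : ℂ) = Real.sqrt α⁻¹ := by
    rw [← Complex.ofReal_mul, Real.sqrt_inv, ← div_eq_mul_inv, Real.sqrt_div_self',
      one_div]
  rw [h, integral_const_mul, integral_comp_mul_left_Ioi (fun k : ℝ =>
    Complex.exp (Complex.I * ((α⁻¹ * x : ℝ) : ℂ) * (k : ℂ)) * φ k) 0 hα, mul_zero,
    Complex.real_smul, ← hs]
  ring

lemma inner_proj_fourier_dilation (hα : 0 < α) (φ ψ : Hp) :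
    inner ℂ (R (T φ)) (Pm (R (T ψ))) = inner ℂ (R φ) (Pm (R ψ)) := by
  revert ψ
  refine dense_integrable_Hp.induction (fun ψ hψ => ?_)
    (isClosed_eq (by fun_prop) (by fun_prop))
  revert φ
  refine dense_integrable_Hp.induction (fun φ hφ => ?_)
    (isClosed_eq (by fun_prop) (by fun_prop))
  have hinner (f g : HL) :
      inner ℂ f (Pm g) = ∫ x, (Set.Iio (0:ℝ)).indicator (fun x => inner ℂ (f x) (g x)) x := by
    rw [L2.inner_def]
    refine integral_congr_ae ?_
    filter_upwards [hSetup.hPm g] with x hx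
    rw [hx]
    by_cases h : x ∈ Set.Iio (0:ℝ) <;> simp [h]
  rw [hinner, hinner]
  have h : (fun x => (Set.Iio (0:ℝ)).indicator
        (fun x => inner ℂ ((R (T φ) : ℝ → ℂ) x) ((R (T ψ) : ℝ → ℂ) x)) x) =ᵐ[volume]
      fun x => α⁻¹ • (Set.Iio (0:ℝ)).indicator
        (fun x => inner ℂ ((R φ : ℝ → ℂ) x) ((R ψ : ℝ → ℂ) x)) (α⁻¹ * x) := by
    filter_upwards [fourier_dilation_ae hT hSetup hα hφ,
      fourier_dilation_ae hT hSetup hα hψ] with x h₁ h₂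
    have hs : (Real.sqrt α⁻¹ : ℂ) * Real.sqrt α⁻¹ = (α⁻¹ : ℝ) := by
      exact_mod_cast Real.mul_self_sqrt (inv_nonneg.2 hα.le)
    by_cases hx : x < 0
    · have hx' : α⁻¹ * x < 0 := mul_neg_of_pos_of_neg (inv_pos.2 hα) hx
      rw [Set.indicator_of_mem (by exact hx), Set.indicator_of_mem (by exact hx'), h₁, h₂,
        Complex.real_smul, ← hs]
      simp only [RCLike.inner_apply, map_mul, Complex.conj_ofReal]
      ring
    · have hx' : ¬ α⁻¹ * x < 0 :=
        not_lt.2 (mul_nonneg (inv_nonneg.2 hα.le) (not_lt.1 hx))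
      rw [Set.indicator_of_notMem (by exact hx), Set.indicator_of_notMem (by exact hx'),
        smul_zero]
  rw [integral_congr_ae h, integral_smul, Measure.integral_comp_mul_left, inv_inv,
    abs_of_pos hα, inv_smul_smul₀ hα.ne']

lemma adjoint_comp_B1_comp_dilation (hα : 0 < α) (t₁ t₂ : ℝ) :
    (adjoint T).comp ((B1 S R Pm t₁ t₂).comp T) = B1 S R Pm (t₁ / α^2) (t₂ / α^2) := by
  have hST (t : ℝ) (φ : Hp) : S t (T φ) = T (S (t / α^2) φ) :=
    DFunLike.congr_fun (evolution_comp_dilation hT hSetup.hS hα t) φ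
  refine ContinuousLinearMap.ext fun ψ => ext_inner_left ℂ fun φ => ?_
  simp only [B1, comp_apply, sub_apply, map_sub, inner_sub_right, adjoint_inner_right, hST,
    inner_proj_fourier_dilation hT hSetup hα]

end Dilation

lemma adjoint_comp_B1_comp_evolution {S : ℝ → Hp →L[ℂ] Hp} {R : Hp →L[ℂ] HL}
    {Pm : HL →L[ℂ] HL} (hSetup : Setup S R Pm) (t₁ t₂ τ : ℝ) :
    (adjoint (S τ)).comp ((B1 S R Pm t₁ t₂).comp (S τ)) = B1 S R Pm (t₁ + τ) (t₂ + τ) := by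
  have hSS (t : ℝ) (φ : Hp) : S t (S τ φ) = S (t + τ) φ :=
    DFunLike.congr_fun (evolution_comp hSetup.hS t τ) φ
  refine ContinuousLinearMap.ext fun ψ => ext_inner_left ℂ fun φ => ?_
  simp only [B1, comp_apply, sub_apply, map_sub, inner_sub_right, adjoint_inner_right, hSS]

/-- covariance of the single backflow operators under time translations and
dilations, and the resulting unitary equivalence and equality of spectra for any two pairs
of times. -/
theorem single_backflow_covariance
    (S : ℝ → Hp →L[ℂ] Hp) (R : Hp →L[ℂ] HL) (Pm : HL →L[ℂ] HL)
    (hSetup : Setup S R Pm)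
    (D : ℝ → Hp →L[ℂ] Hp)
    (hD : ∀ α : ℝ, 0 < α → ∀ φ : Hp,
      (D α φ : ℝ → ℂ) =ᵐ[μp] fun k => (Real.sqrt α : ℂ) * φ (α * k))
    (t₁ t₂ : ℝ) (h12 : t₁ < t₂) :
    (∀ τ : ℝ,
      (ContinuousLinearMap.adjoint (S τ)).comp ((B1 S R Pm t₁ t₂).comp (S τ))
        = B1 S R Pm (t₁ + τ) (t₂ + τ)) ∧
    (∀ α : ℝ, 0 < α →
      (ContinuousLinearMap.adjoint (D α)).comp ((B1 S R Pm t₁ t₂).comp (D α))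
        = B1 S R Pm (t₁ / α^2) (t₂ / α^2)) ∧
    (∀ s₁ s₂ : ℝ, s₁ < s₂ →
      ∃ U : Hp →L[ℂ] Hp, U ∈ unitary (Hp →L[ℂ] Hp) ∧
        B1 S R Pm s₁ s₂
          = (ContinuousLinearMap.adjoint U).comp ((B1 S R Pm t₁ t₂).comp U) ∧
        spectrum ℝ (B1 S R Pm s₁ s₂) = spectrum ℝ (B1 S R Pm t₁ t₂)) := by
  have hevol := adjoint_comp_B1_comp_evolution hSetup
  have hdil : ∀ α : ℝ, 0 < α → ∀ t₁ t₂ : ℝ,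
      (adjoint (D α)).comp ((B1 S R Pm t₁ t₂).comp (D α))
        = B1 S R Pm (t₁ / α^2) (t₂ / α^2) :=
    fun α hα => adjoint_comp_B1_comp_dilation (hD α hα) hSetup hα
  refine ⟨hevol t₁ t₂, fun α hα => hdil α hα t₁ t₂, fun s₁ s₂ hs => ?_⟩
  have ht : 0 < t₂ - t₁ := sub_pos.2 h12
  have hs' : 0 < s₂ - s₁ := sub_pos.2 hs
  set α := Real.sqrt ((t₂ - t₁) / (s₂ - s₁))
  have hα : 0 < α := Real.sqrt_pos.2 (div_pos ht hs')
  have hα2 : α^2 = (t₂ - t₁) / (s₂ - s₁) := Real.sq_sqrt (div_pos ht hs').le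
  have hU : D α * S (s₁ - t₁ / α^2) ∈ unitary (Hp →L[ℂ] Hp) :=
    mul_mem (dilation_mem_unitary (hD α hα) hα (hD α⁻¹ (inv_pos.2 hα)))
      (evolution_mem_unitary hSetup.hS _)
  have hB : B1 S R Pm s₁ s₂ = (adjoint (D α * S (s₁ - t₁ / α^2))).comp
      ((B1 S R Pm t₁ t₂).comp (D α * S (s₁ - t₁ / α^2))) := by
    have h₂ : t₂ / α^2 + (s₁ - t₁ / α^2) = s₂ := by
      rw [hα2]
      field_simp
      ring
    calc B1 S R Pm s₁ s₂
        = B1 S R Pm (t₁ / α^2 + (s₁ - t₁ / α^2)) (t₂ / α^2 + (s₁ - t₁ / α^2)) := by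
          rw [h₂, add_sub_cancel]
      _ = _ := by
          rw [← hevol, ← hdil α hα]
          simp only [mul_def, adjoint_comp, comp_assoc]
  refine ⟨_, hU, hB, ?_⟩
  rw [hB]
  exact Unitary.spectrum_star_left_conjugate (R := ℝ) (a := B1 S R Pm t₁ t₂) (U := ⟨_, hU⟩)

end QB
end
end

section
/- For every integer M ≥ 1, the function 𝒯_M → ℝ given by t ↦ sSup σ(B^{(M)}_t) is lower semicontinuous on 𝒯_M ⊆ ℝ^{2M}, and the function t ↦ sInf σ(B^{(M)}_t) is upper semicontinuous on 𝒯_M. -/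
open MeasureTheory Filter

noncomputable section

namespace QB

section SpectralBounds

open scoped InnerProductSpace

variable {H : Type*} [NormedAddCommGroup H] [InnerProductSpace ℂ H] [CompleteSpace H]

theorem le_algebraMap_iff_re_inner_le {T : H →L[ℂ] H} (hT : IsSelfAdjoint T) (r : ℝ) :
    T ≤ algebraMap ℝ (H →L[ℂ] H) r ↔ ∀ φ : H, RCLike.re ⟪T φ, φ⟫_ℂ ≤ r * ‖φ‖ ^ 2 := by
  have hsa : IsSelfAdjoint (algebraMap ℝ (H →L[ℂ] H) r - T) :=
    (IsSelfAdjoint.algebraMap _ (IsSelfAdjoint.all r)).sub hT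
  rw [ContinuousLinearMap.le_def, ContinuousLinearMap.isPositive_def']
  simp only [hsa, true_and]
  refine forall_congr' fun φ => ?_
  have h : algebraMap ℝ (H →L[ℂ] H) r φ = (r : ℂ) • φ := by
    rw [Algebra.algebraMap_eq_smul_one]
    simp
  rw [ContinuousLinearMap.reApplyInnerSelf_apply, sub_apply, h, inner_sub_left, inner_smul_left,
    map_sub, sub_nonneg, inner_self_eq_norm_sq_to_K]
  have h2 : RCLike.re ((starRingEnd ℂ) (r : ℂ) * ((‖φ‖ : ℂ)) ^ 2) = r * ‖φ‖ ^ 2 := by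
    rw [Complex.conj_ofReal]
    norm_cast
  exact (congrArg (fun x : ℝ => _ ≤ x) h2).to_iff

theorem lowerSemicontinuous_sSup_spectrum {X : Type*} [TopologicalSpace X]
    {T : X → H →L[ℂ] H} (hT : ∀ x, IsSelfAdjoint (T x))
    (hc : ∀ φ : H, Continuous fun x => RCLike.re ⟪T x φ, φ⟫_ℂ) :
    LowerSemicontinuous fun x => sSup (spectrum ℝ (T x)) := by
  rcases subsingleton_or_nontrivial H with hH | hH
  · have h : ∀ x, T x = 0 := fun x => Subsingleton.elim _ _
    simp only [h]
    exact continuous_const.lowerSemicontinuous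
  intro x y hy
  obtain ⟨φ, hφ⟩ : ∃ φ : H, y * ‖φ‖ ^ 2 < RCLike.re ⟪T x φ, φ⟫_ℂ := by
    by_contra! h
    have hle := (le_algebraMap_iff_re_inner_le (hT x) y).2 h
    rw [le_algebraMap_iff_spectrum_le (ha := hT x)] at hle
    exact hy.not_ge
      (csSup_le (ContinuousFunctionalCalculus.spectrum_nonempty (R := ℝ) (T x) (hT x)) hle)
  filter_upwards [(hc φ).continuousAt.eventually_const_lt hφ] with z hz
  have hle : T z ≤ algebraMap ℝ (H →L[ℂ] H) (sSup (spectrum ℝ (T z))) :=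
    le_algebraMap_of_spectrum_le
      (fun r hr => le_csSup (spectrum.isCompact (𝕜 := ℝ) (T z)).bddAbove hr) (hT z)
  have hR := (le_algebraMap_iff_re_inner_le (hT z) _).1 hle φ
  exact lt_of_mul_lt_mul_right (hz.trans_le hR) (sq_nonneg _)

theorem upperSemicontinuous_sInf_spectrum {X : Type*} [TopologicalSpace X]
    {T : X → H →L[ℂ] H} (hT : ∀ x, IsSelfAdjoint (T x))
    (hc : ∀ φ : H, Continuous fun x => RCLike.re ⟪T x φ, φ⟫_ℂ) :
    UpperSemicontinuous fun x => sInf (spectrum ℝ (T x)) := by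
  have h := lowerSemicontinuous_sSup_spectrum (T := fun x => -T x) (fun x => (hT x).neg)
    (fun φ => by simpa only [neg_apply, inner_neg_left, map_neg] using! (hc φ).neg)
  intro x y hy
  have hy' : -y < sSup (spectrum ℝ (-T x)) := by
    rwa [← spectrum.neg_eq, neg_lt, ← Real.sInf_def]
  filter_upwards [h x _ hy'] with z hz
  rwa [← spectrum.neg_eq, gt_iff_lt, neg_lt, ← Real.sInf_def] at hz

end SpectralBounds

theorem norm_sq_eq_integral {α E : Type*} [MeasurableSpace α] {μ : Measure α}
    [NormedAddCommGroup E] [InnerProductSpace ℂ E] (f : Lp E 2 μ) :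
    ‖f‖ ^ 2 = ∫ a, ‖f a‖ ^ 2 ∂μ := by
  have h : (inner ℂ f f : ℂ) = ((∫ a, ‖f a‖ ^ 2 ∂μ : ℝ) : ℂ) := by
    rw [L2.inner_def, ← integral_complex_ofReal]
    simp [inner_self_eq_norm_sq_to_K]
  rw [inner_self_eq_norm_sq_to_K] at h
  exact Complex.ofReal_injective ((Complex.ofReal_pow _ _).trans h)

section Operators

variable {S : ℝ → Hp →L[ℂ] Hp} {R : Hp →L[ℂ] HL} {Pm : HL →L[ℂ] HL}

theorem Setup.continuous_S (h : Setup S R Pm) (φ : Hp) : Continuous fun t => S t φ := by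
  rw [continuous_iff_continuousAt]
  intro s
  have key : Tendsto (fun t => ∫ k, ‖(S t φ - S s φ : Hp) k‖ ^ 2 ∂μp) (nhds s)
      (nhds (∫ _ : ℝ, (0 : ℝ) ∂μp)) := by
    have hcoe : ∀ t, (S t φ - S s φ : Hp) =ᵐ[μp] fun k =>
        (Complex.exp (-Complex.I * (k:ℂ)^2 * (t:ℂ)) -
          Complex.exp (-Complex.I * (k:ℂ)^2 * (s:ℂ))) * φ k := fun t => by
      filter_upwards [Lp.coeFn_sub (S t φ) (S s φ), h.hS t φ, h.hS s φ] with k h1 h2 h3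
      rw [h1, Pi.sub_apply, h2, h3, sub_mul]
    have hint : ∀ t, ∫ k, ‖(S t φ - S s φ : Hp) k‖ ^ 2 ∂μp =
        ∫ k, ‖(Complex.exp (-Complex.I * (k:ℂ)^2 * (t:ℂ)) -
          Complex.exp (-Complex.I * (k:ℂ)^2 * (s:ℂ))) * φ k‖ ^ 2 ∂μp := fun t =>
      integral_congr_ae ((hcoe t).mono fun k hk => by simp only [hk])
    simp only [hint]
    have hmeas : AEStronglyMeasurable (φ : ℝ → ℂ) μp := Lp.aestronglyMeasurable φ
    refine tendsto_integral_filter_of_dominated_convergence (fun k => (2 * ‖φ k‖) ^ 2)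
      (Eventually.of_forall fun t => ?_) (Eventually.of_forall fun t => ?_) ?_ ?_
    · exact ((Continuous.aestronglyMeasurable (by fun_prop)).mul hmeas).norm.pow 2
    · refine Eventually.of_forall fun k => ?_
      have hexp : ∀ u : ℝ, ‖Complex.exp (-Complex.I * (k:ℂ)^2 * (u:ℂ))‖ = 1 := fun u => by
        have : -Complex.I * (k:ℂ)^2 * (u:ℂ) = ((-(k ^ 2 * u) : ℝ) : ℂ) * Complex.I := by
          push_cast; ring
        rw [this, Complex.norm_exp_ofReal_mul_I]
      rw [norm_pow, norm_norm, norm_mul]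
      gcongr
      refine (norm_sub_le _ _).trans ?_
      rw [hexp, hexp]
      norm_num
    · simp only [mul_pow]
      exact ((memLp_two_iff_integrable_sq_norm hmeas).1 (Lp.memLp φ)).const_mul _
    · refine Eventually.of_forall fun k => ?_
      have hk : Continuous fun t : ℝ => ‖(Complex.exp (-Complex.I * (k:ℂ)^2 * (t:ℂ)) -
          Complex.exp (-Complex.I * (k:ℂ)^2 * (s:ℂ))) * φ k‖ ^ 2 := by fun_prop
      simpa using hk.tendsto s
  simp only [← norm_sq_eq_integral, integral_zero] at key
  have h2 := key.sqrt
  simp only [Real.sqrt_sq (norm_nonneg _), Real.sqrt_zero] at h2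
  exact tendsto_iff_norm_sub_tendsto_zero.2 h2

theorem Setup.isSelfAdjoint_BM (h : Setup S R Pm) (M : ℕ) (t : Fin (2*M) → ℝ) :
    IsSelfAdjoint (BM S R Pm M t) :=
  isSelfAdjoint_sum _ fun _ _ => h.isSelfAdjoint_B1 _ _

theorem Setup.continuous_re_inner_BM (h : Setup S R Pm) (M : ℕ) (φ : Hp) :
    Continuous fun t : Fin (2*M) → ℝ => RCLike.re (inner ℂ (BM S R Pm M t φ) φ) := by
  have hS := h.continuous_S φ
  simp only [BM, B1, sum_apply, sub_apply, ContinuousLinearMap.comp_apply,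
    sum_inner, inner_sub_left, ContinuousLinearMap.adjoint_inner_left]
  fun_prop

end Operators

/-- the map `t ↦ sSup σ(B^{(M)}_t)` is lower semicontinuous on `𝒯_M`,
and `t ↦ sInf σ(B^{(M)}_t)` is upper semicontinuous on `𝒯_M`. -/
theorem backflow_spectral_bounds_semicontinuous
    (S : ℝ → Hp →L[ℂ] Hp) (R : Hp →L[ℂ] HL) (Pm : HL →L[ℂ] HL)
    (hSetup : Setup S R Pm) (M : ℕ) (hM : 1 ≤ M) :
    LowerSemicontinuousOn
      (fun t : Fin (2*M) → ℝ => sSup (spectrum ℝ (BM S R Pm M t))) (TM M) ∧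
    UpperSemicontinuousOn
      (fun t : Fin (2*M) → ℝ => sInf (spectrum ℝ (BM S R Pm M t))) (TM M) := by
  have hsa := hSetup.isSelfAdjoint_BM M
  have hc := hSetup.continuous_re_inner_BM M
  exact ⟨(lowerSemicontinuous_sSup_spectrum hsa hc).lowerSemicontinuousOn _,
    (upperSemicontinuous_sInf_spectrum hsa hc).upperSemicontinuousOn _⟩

end QB
end
end

section
/- Let M ≥ 2 be an even integer and ε ∈ (0, π/6]. Set I₀ = [0, ε/M] and I₁ = [π/2 − ε/(2M), π/2 + ε/(2M)]. Then −(M/(8πε)) · ∫_{I₀∪I₁} ∫_{I₀∪I₁} [ sin(2M(p−q)) / ((p−q)·cos(p−q)) ] · [ (p/q)^{1/4} + (q/p)^{1/4} ] dq dp ≥ (2^{7/4} ε^{3/4} / (3 π^{11/4})) · M^{1/4} · S(2ε/(πM)), where S(η) = 1 − (31π²/80)·η^{1/4} − (5/8)·η − (9π²/176)·η^{5/4}. (The integrand is defined for p ≠ q; the diagonal p = q is a Lebesgue-null set and does not affect the double integral.) -/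
open MeasureTheory Real

lemma abs_sin_div_mul_cos_le {m u : ℝ} (hm : 1 ≤ m) (hu : m * |u| ≤ π / 6) :
    |sin (2 * m * u) / (u * cos u)| ≤ 2 * m := by
  rcases eq_or_ne u 0 with rfl | hne
  · simp; linarith
  have hu0 : 0 < |u| := abs_pos.mpr hne
  have hle : |u| ≤ m * |u| := by nlinarith
  have hcos : 0 < cos u := by
    rw [← cos_abs]
    exact cos_pos_of_mem_Ioo ⟨by linarith [pi_pos], by linarith [pi_pos]⟩
  have hmu : |m * u| = m * |u| := by rw [abs_mul, abs_of_pos (by linarith)]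
  have hcos' : |cos (m * u)| ≤ cos u := by
    rw [← cos_abs (m * u), ← cos_abs u, hmu,
      abs_of_pos (cos_pos_of_mem_Ioo ⟨by linarith [pi_pos], by linarith [pi_pos]⟩)]
    exact cos_le_cos_of_nonneg_of_le_pi hu0.le (by linarith [pi_pos]) hle
  rw [abs_div, abs_mul, abs_of_pos hcos, div_le_iff₀ (by positivity)]
  have h2 : sin (2 * m * u) = 2 * sin (m * u) * cos (m * u) := by
    rw [mul_assoc, sin_two_mul]
  rw [h2, abs_mul, abs_mul, abs_two]
  have h3 : |sin (m * u)| ≤ m * |u| := hmu ▸ abs_sin_le_abs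
  calc 2 * |sin (m * u)| * |cos (m * u)| ≤ 2 * (m * |u|) * cos u := by gcongr
    _ = _ := by ring

lemma sin_mul_div_sin_abs (c w : ℝ) : sin (c * |w|) / sin |w| = sin (c * w) / sin w := by
  rcases abs_choice w with h | h <;> rw [h]
  rw [mul_neg, sin_neg, sin_neg, neg_div_neg_eq]

lemma sin_mul_div_sin_bounds {m w : ℝ} (hm : 0 < m) (hw : w ≠ 0) (h1 : |w| ≤ π / 2)
    (h2 : 2 * m * |w| ≤ π / 2) :
    2 * m * (1 - (2 * m * w) ^ 2 / 6) ≤ sin (2 * m * w) / sin w ∧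
      sin (2 * m * w) / sin w ≤ 4 * m := by
  rw [← sin_mul_div_sin_abs, ← sq_abs (2 * m * w), abs_mul, abs_of_pos (by linarith : 0 < 2 * m)]
  have hw0 : 0 < |w| := abs_pos.mpr hw
  generalize |w| = v at *
  have hs : 2 / π * v ≤ sin v := mul_le_sin hw0.le h1
  have hs' : sin v ≤ v := sin_le hw0.le
  have hspos : 0 < sin v := lt_of_lt_of_le (by positivity) hs
  have hc := sin_ge_sub_cube (x := 2 * m * v) (by positivity)
  have hc' : sin (2 * m * v) ≤ 2 * m * v := sin_le (by positivity)
  constructor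
  · rw [le_div_iff₀ hspos]
    have h3 : 0 ≤ 1 - (2 * m * v) ^ 2 / 6 := by nlinarith [pi_le_four, mul_pos hm hw0]
    calc 2 * m * (1 - (2 * m * v) ^ 2 / 6) * sin v ≤ 2 * m * (1 - (2 * m * v) ^ 2 / 6) * v := by
          gcongr
      _ = 2 * m * v - (2 * m * v) ^ 3 / 6 := by ring
      _ ≤ _ := hc
  · rw [div_le_iff₀ hspos]
    have : v / 2 ≤ sin v := by
      refine le_trans ?_ hs
      rw [div_mul_eq_mul_div, div_le_div_iff₀ two_pos pi_pos]
      nlinarith [pi_le_four]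
    nlinarith

lemma sin_div_mul_cos_add_pi_div_two {M : ℕ} (hM : Even M) (w : ℝ) :
    sin (2 * M * (π / 2 + w)) / ((π / 2 + w) * cos (π / 2 + w)) =
      -(sin (2 * M * w) / sin w / (π / 2 + w)) := by
  obtain ⟨k, rfl⟩ := hM
  have h1 : sin (2 * ((k + k : ℕ) : ℝ) * (π / 2 + w)) = sin (2 * ((k + k : ℕ) : ℝ) * w) := by
    rw [← sin_add_nat_mul_two_pi (2 * ((k + k : ℕ) : ℝ) * w) k]
    congr 1
    push_cast
    ring
  have h2 : cos (π / 2 + w) = -sin w := by rw [add_comm, cos_add_pi_div_two]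
  rw [h1, h2, div_div, mul_neg, div_neg, mul_comm (sin w)]

lemma one_sub_le_rpow_neg {x : ℝ} (hx : -1 < x) :
    1 - 3 / 4 * x ≤ (1 + x) ^ (-(3 / 4) : ℝ) := by
  have h := rpow_one_add_le_one_add_mul_self hx.le (p := 3 / 4) (by norm_num) (by norm_num)
  have hpos : 0 < (1 + x) ^ (3 / 4 : ℝ) := rpow_pos_of_pos (by linarith) _
  rw [rpow_neg (by linarith), ← one_div, le_div_iff₀ hpos]
  by_cases h1 : 0 ≤ 1 - 3 / 4 * x
  · nlinarith [mul_le_mul_of_nonneg_left h h1, sq_nonneg x]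
  · nlinarith

lemma rpow_div_eq {p q r : ℝ} (hp : 0 ≤ p) (hq : 0 ≤ q) :
    (p / q) ^ r = p ^ r * q ^ (-r) := by
  rw [div_rpow hp hq, rpow_neg hq, div_eq_mul_inv]

lemma weight_div_ge {s t : ℝ} (hs : |s| ≤ π / 24) (ht : 0 < t) :
    (π / 2) ^ (-(3 / 4) : ℝ) * (1 - 3 / (2 * π) * s) * t ^ (-(1 / 4) : ℝ) +
        9 / 10 * (π / 2) ^ (-(5 / 4) : ℝ) * t ^ (1 / 4 : ℝ) ≤
      (((π / 2 + s) / t) ^ (1 / 4 : ℝ) + (t / (π / 2 + s)) ^ (1 / 4 : ℝ)) / (π / 2 + s) := by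
  have hpi := pi_pos
  obtain ⟨hs1, hs2⟩ := abs_le.mp hs
  have hp : 0 < π / 2 + s := by linarith
  have key : π / 2 + s = π / 2 * (1 + 2 * s / π) := by field_simp
  have hx : -1 < 2 * s / π := by rw [lt_div_iff₀ hpi]; linarith
  have hx2 : 1 + 2 * s / π ≤ 13 / 12 := by
    have : 2 * s / π ≤ 1 / 12 := by rw [div_le_iff₀ hpi]; linarith
    linarith
  have hx1 : 0 < 1 + 2 * s / π := by linarith
  have e1 : (π / 2 + s) ^ (1 / 4 : ℝ) / (π / 2 + s) = (π / 2 + s) ^ (-(3 / 4) : ℝ) := by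
    rw [← rpow_sub_one hp.ne']; norm_num
  have e2 : (π / 2 + s) ^ (-(1 / 4) : ℝ) / (π / 2 + s) = (π / 2 + s) ^ (-(5 / 4) : ℝ) := by
    rw [← rpow_sub_one hp.ne']; norm_num
  have f1 : (π / 2) ^ (-(3 / 4) : ℝ) * (1 - 3 / (2 * π) * s) ≤ (π / 2 + s) ^ (-(3 / 4) : ℝ) := by
    rw [key, mul_rpow (by positivity) hx1.le]
    gcongr
    refine le_trans (le_of_eq ?_) (one_sub_le_rpow_neg hx)
    field_simp
    ring
  have f2 : 9 / 10 * (π / 2) ^ (-(5 / 4) : ℝ) ≤ (π / 2 + s) ^ (-(5 / 4) : ℝ) := by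
    rw [key, mul_rpow (by positivity) hx1.le, mul_comm]
    gcongr
    rw [rpow_neg hx1.le, ← one_div, le_div_iff₀ (by positivity)]
    have h1 : (1 + 2 * s / π) ^ (5 / 4 : ℝ) ≤ 10 / 9 := by
      have h2 : ((1 + 2 * s / π) ^ (5 / 4 : ℝ)) ^ 4 = (1 + 2 * s / π) ^ 5 := by
        rw [← rpow_natCast, ← rpow_mul hx1.le, ← rpow_natCast]; norm_num
      refine le_of_pow_le_pow_left₀ (n := 4) (by norm_num) (by norm_num) ?_
      rw [h2]
      calc (1 + 2 * s / π) ^ 5 ≤ (13 / 12) ^ 5 := by gcongr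
        _ ≤ _ := by norm_num
    linarith
  rw [rpow_div_eq hp.le ht.le, rpow_div_eq ht.le hp.le, add_div, mul_div_right_comm, e1,
    mul_div_assoc, e2, mul_comm (t ^ (1 / 4 : ℝ))]
  gcongr

/-- The kernel of the `M`-fold backflow operator, up to the factor `-1 / (4 * π)`. -/
noncomputable def backflowKernel (M p q : ℝ) : ℝ :=
  sin (2 * M * (p - q)) / ((p - q) * cos (p - q)) *
    ((p / q) ^ ((1 : ℝ) / 4) + (q / p) ^ ((1 : ℝ) / 4))

lemma backflowKernel_comm (M p q : ℝ) : backflowKernel M p q = backflowKernel M q p := by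
  unfold backflowKernel
  rw [← neg_sub q p, mul_neg, sin_neg, cos_neg, neg_mul, neg_div_neg_eq, add_comm]

lemma measurable_backflowKernel (M : ℝ) :
    Measurable fun z : ℝ × ℝ => backflowKernel M z.1 z.2 := by
  unfold backflowKernel
  fun_prop

lemma weight_nonneg {p q : ℝ} (hp : 0 ≤ p) (hq : 0 ≤ q) :
    0 ≤ (p / q) ^ ((1 : ℝ) / 4) + (q / p) ^ ((1 : ℝ) / 4) := by positivity

lemma abs_backflowKernel_le_of_near {M p q : ℝ} (hM : 1 ≤ M) (hp : 0 ≤ p) (hq : 0 ≤ q)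
    (h : M * |p - q| ≤ π / 6) :
    |backflowKernel M p q| ≤ 2 * M * ((p / q) ^ ((1 : ℝ) / 4) + (q / p) ^ ((1 : ℝ) / 4)) := by
  unfold backflowKernel
  rw [abs_mul, abs_of_nonneg (weight_nonneg hp hq)]
  gcongr
  exact abs_sin_div_mul_cos_le hM h

section

variable {M : ℕ} {d s t : ℝ}

lemma cross_bounds (hM : 2 ≤ M) (hd : M * d ≤ π / 6) (hs : |s| ≤ d / 2) (ht : 0 ≤ t)
    (htd : t ≤ d) :
    d ≤ π / 12 ∧ |s - t| ≤ π / 8 ∧ 2 * M * |s - t| ≤ π / 2 := by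
  have hM' : (2 : ℝ) ≤ M := by exact_mod_cast hM
  have h1 : |s - t| ≤ 3 / 2 * d := by
    rw [abs_le] at hs ⊢
    constructor <;> linarith
  have h2 : d ≤ π / 12 := by nlinarith
  refine ⟨h2, by linarith, ?_⟩
  nlinarith

lemma abs_backflowKernel_le_of_cross (hM : 2 ≤ M) (hMe : Even M) (hd : M * d ≤ π / 6)
    (hs : |s| ≤ d / 2) (ht : 0 ≤ t) (htd : t ≤ d) :
    |backflowKernel M (π / 2 + s) t| ≤
      4 * M * (((π / 2 + s) / t) ^ ((1 : ℝ) / 4) + (t / (π / 2 + s)) ^ ((1 : ℝ) / 4)) := by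
  obtain ⟨h1, h2, h3⟩ := cross_bounds hM hd hs ht htd
  have hpi := pi_gt_three
  have hM' : (2 : ℝ) ≤ M := by exact_mod_cast hM
  have hp : 0 ≤ π / 2 + s := by linarith [(abs_le.mp hs).1]
  unfold backflowKernel
  rw [abs_mul, abs_of_nonneg (weight_nonneg hp ht), add_sub_assoc,
    sin_div_mul_cos_add_pi_div_two hMe, abs_neg, abs_div]
  gcongr
  have hw1 : 1 ≤ π / 2 + (s - t) := by linarith [(abs_le.mp h2).1]
  rw [abs_of_nonneg (by linarith : 0 ≤ π / 2 + (s - t)), div_le_iff₀ (by linarith)]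
  rcases eq_or_ne (s - t) 0 with h0 | h0
  · rw [h0]; simp; positivity
  obtain ⟨h4, h5⟩ := sin_mul_div_sin_bounds (m := M) (by linarith) h0 (by linarith) h3
  have h6 : 0 ≤ 2 * (M : ℝ) * (1 - (2 * M * (s - t)) ^ 2 / 6) := by
    rw [← sq_abs, abs_mul, abs_of_nonneg (by linarith : 0 ≤ 2 * (M : ℝ))]
    have : (2 * M * |s - t|) ^ 2 ≤ 2 ^ 2 := by
      gcongr; linarith [pi_le_four]
    have : 0 ≤ 1 - (2 * M * |s - t|) ^ 2 / 6 := by linarith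
    positivity
  rw [abs_of_nonneg (h6.trans h4)]
  nlinarith

lemma neg_backflowKernel_ge_of_cross (hM : 2 ≤ M) (hMe : Even M) (hd : M * d ≤ π / 6)
    (hs : |s| ≤ d / 2) (ht : 0 < t) (htd : t ≤ d) (hst : s ≠ t) :
    2 * M * (1 - (2 * M * (s - t)) ^ 2 / 6) *
      ((π / 2) ^ (-(3 / 4) : ℝ) * (1 - 3 / (2 * π) * s) * t ^ (-(1 / 4) : ℝ) +
        9 / 10 * (π / 2) ^ (-(5 / 4) : ℝ) * t ^ (1 / 4 : ℝ)) ≤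
    -backflowKernel M (π / 2 + s) t := by
  obtain ⟨h1, h2, h3⟩ := cross_bounds hM hd hs ht.le htd
  have hpi := pi_gt_three
  have hM' : (2 : ℝ) ≤ M := by exact_mod_cast hM
  have hp : 0 ≤ π / 2 + s := by linarith [(abs_le.mp hs).1]
  have hw1 : 1 ≤ π / 2 + (s - t) := by linarith [(abs_le.mp h2).1]
  obtain ⟨h4, h5⟩ := sin_mul_div_sin_bounds (m := M) (by linarith) (sub_ne_zero.mpr hst)
    (by linarith) h3
  have h6 : 0 ≤ 2 * (M : ℝ) * (1 - (2 * M * (s - t)) ^ 2 / 6) := by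
    rw [← sq_abs, abs_mul, abs_of_nonneg (by linarith : 0 ≤ 2 * (M : ℝ))]
    have : (2 * M * |s - t|) ^ 2 ≤ 2 ^ 2 := by
      gcongr; linarith [pi_le_four]
    have : 0 ≤ 1 - (2 * M * |s - t|) ^ 2 / 6 := by linarith
    positivity
  unfold backflowKernel
  rw [add_sub_assoc, sin_div_mul_cos_add_pi_div_two hMe, neg_mul, neg_neg,
    div_mul_eq_mul_div (sin _ / sin _), mul_div_assoc (sin _ / sin _)]
  refine (mul_le_mul_of_nonneg_left (weight_div_ge (hs.trans (by linarith)) ht) h6).trans ?_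
  refine mul_le_mul h4 ?_ (div_nonneg (weight_nonneg hp ht.le) hp) (h6.trans h4)
  exact div_le_div_of_nonneg_left (weight_nonneg hp ht.le) (by linarith) (by linarith)

end

/-- `f` is integrable on `s` with integral `a`. -/
def HasSetIntegral {X : Type*} [MeasurableSpace X] (μ : Measure X) (f : X → ℝ) (s : Set X)
    (a : ℝ) : Prop :=
  IntegrableOn f s μ ∧ ∫ x in s, f x ∂μ = a

namespace HasSetIntegral

variable {X Y : Type*} [MeasurableSpace X] [MeasurableSpace Y] {μ : Measure X} {ν : Measure Y}
  {f g : X → ℝ} {s : Set X} {a b : ℝ}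

lemma add (hf : HasSetIntegral μ f s a) (hg : HasSetIntegral μ g s b) :
    HasSetIntegral μ (fun x => f x + g x) s (a + b) :=
  ⟨hf.1.add hg.1, by rw [integral_add hf.1 hg.1, hf.2, hg.2]⟩

lemma const_mul (hf : HasSetIntegral μ f s a) (c : ℝ) :
    HasSetIntegral μ (fun x => c * f x) s (c * a) :=
  ⟨hf.1.const_mul c, by rw [integral_const_mul, hf.2]⟩

lemma prod_mul [SFinite μ] [SFinite ν] {g : Y → ℝ} {t : Set Y} (hf : HasSetIntegral μ f s a)
    (hg : HasSetIntegral ν g t b) :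
    HasSetIntegral (μ.prod ν) (fun z => f z.1 * g z.2) (s ×ˢ t) (a * b) := by
  refine ⟨?_, by rw [setIntegral_prod_mul, hf.2, hg.2]⟩
  rw [IntegrableOn, ← Measure.prod_restrict]
  exact Integrable.mul_prod hf.1 hg.1

end HasSetIntegral

lemma hasSetIntegral_rpow {d r : ℝ} (hd : 0 ≤ d) (hr : -1 < r) :
    HasSetIntegral volume (fun x : ℝ => x ^ r) (Set.Icc 0 d) (d ^ (r + 1) / (r + 1)) := by
  constructor
  · rw [integrableOn_Icc_iff_integrableOn_Ioc, ← intervalIntegrable_iff_integrableOn_Ioc_of_le hd]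
    exact intervalIntegral.intervalIntegrable_rpow' hr
  · rw [integral_Icc_eq_integral_Ioc, ← intervalIntegral.integral_of_le hd,
      integral_rpow (Or.inl hr), zero_rpow (by linarith), sub_zero]

lemma hasSetIntegral_cubic {h : ℝ} (hh : 0 ≤ h) (a c₀ c₁ c₂ c₃ : ℝ) :
    HasSetIntegral volume
      (fun x : ℝ => c₀ + c₁ * (x - a) + c₂ * (x - a) ^ 2 + c₃ * (x - a) ^ 3)
      (Set.Icc (a - h) (a + h)) (2 * h * c₀ + 2 / 3 * h ^ 3 * c₂) := by
  have hc : Continuous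
      (fun x : ℝ => c₀ + c₁ * (x - a) + c₂ * (x - a) ^ 2 + c₃ * (x - a) ^ 3) := by fun_prop
  refine ⟨hc.integrableOn_Icc, ?_⟩
  rw [integral_Icc_eq_integral_Ioc, ← intervalIntegral.integral_of_le (by linarith),
    intervalIntegral.integral_eq_sub_of_hasDerivAt (f := fun x => c₀ * (x - a) +
      c₁ * (x - a) ^ 2 / 2 + c₂ * (x - a) ^ 3 / 3 + c₃ * (x - a) ^ 4 / 4) (fun x _ => ?_)
      (hc.intervalIntegrable _ _)]
  · ring
  · have h1 : HasDerivAt (fun x : ℝ => x - a) 1 x := (hasDerivAt_id x).sub_const a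
    convert! (((h1.const_mul c₀).add (((h1.pow 2).const_mul c₁).div_const 2)).add
      (((h1.pow 3).const_mul c₂).div_const 3)).add (((h1.pow 4).const_mul c₃).div_const 4) using 1
    simp
    ring

section

variable {M : ℕ} {d : ℝ}

lemma integrableOn_weight {s : Set ℝ} {b : ℝ} (hs : s ⊆ Set.Icc 0 b) (hms : MeasurableSet s) :
    IntegrableOn (fun z : ℝ × ℝ => (z.1 / z.2) ^ ((1 : ℝ) / 4) + (z.2 / z.1) ^ ((1 : ℝ) / 4))
      (s ×ˢ s) (volume.prod volume) := by
  rcases s.eq_empty_or_nonempty with rfl | ⟨x, hx⟩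
  · simp
  have hb : 0 ≤ b := (hs hx).1.trans (hs hx).2
  have h1 : IntegrableOn (fun x : ℝ => x ^ (1 / 4 : ℝ)) s :=
    (hasSetIntegral_rpow hb (by norm_num)).1.mono_set hs
  have h2 : IntegrableOn (fun x : ℝ => x ^ (-(1 / 4) : ℝ)) s :=
    (hasSetIntegral_rpow hb (by norm_num)).1.mono_set hs
  have h : IntegrableOn (fun z : ℝ × ℝ => z.1 ^ (1 / 4 : ℝ) * z.2 ^ (-(1 / 4) : ℝ) +
      z.1 ^ (-(1 / 4) : ℝ) * z.2 ^ (1 / 4 : ℝ)) (s ×ˢ s) (volume.prod volume) := by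
    rw [IntegrableOn, ← Measure.prod_restrict]
    exact (h1.mul_prod h2).add (h2.mul_prod h1)
  refine h.congr_fun (fun z hz => ?_) (hms.prod hms)
  simp only
  rw [rpow_div_eq (hs hz.1).1 (hs hz.2).1, rpow_div_eq (hs hz.2).1 (hs hz.1).1,
    mul_comm (z.2 ^ (1 / 4 : ℝ))]

lemma integrableOn_backflowKernel (hM : 2 ≤ M) (hMe : Even M) (hd0 : 0 ≤ d)
    (hd : M * d ≤ π / 6) :
    IntegrableOn (fun z : ℝ × ℝ => backflowKernel M z.1 z.2)
      ((Set.Icc 0 d ∪ Set.Icc (π / 2 - d / 2) (π / 2 + d / 2)) ×ˢ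
        (Set.Icc 0 d ∪ Set.Icc (π / 2 - d / 2) (π / 2 + d / 2))) (volume.prod volume) := by
  have hM' : (2 : ℝ) ≤ M := by exact_mod_cast hM
  have hpi := pi_gt_three
  have hd12 : d ≤ π / 12 := by nlinarith
  have hms : MeasurableSet (Set.Icc 0 d ∪ Set.Icc (π / 2 - d / 2) (π / 2 + d / 2)) :=
    measurableSet_Icc.union measurableSet_Icc
  have hsub : Set.Icc 0 d ∪ Set.Icc (π / 2 - d / 2) (π / 2 + d / 2) ⊆ Set.Icc 0 π :=
    Set.union_subset (Set.Icc_subset_Icc le_rfl (by linarith))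
      (Set.Icc_subset_Icc (by linarith) (by linarith))
  refine Integrable.mono' ((integrableOn_weight hsub hms).const_mul (4 * M))
    (measurable_backflowKernel M).aestronglyMeasurable
    (ae_restrict_of_forall_mem (hms.prod hms) ?_)
  have near : ∀ p q : ℝ, 0 ≤ p → 0 ≤ q → |p - q| ≤ d → |backflowKernel M p q| ≤
      4 * M * ((p / q) ^ ((1 : ℝ) / 4) + (q / p) ^ ((1 : ℝ) / 4)) := by
    intro p q hp hq h
    refine (abs_backflowKernel_le_of_near (by linarith) hp hq ?_).trans ?_
    · exact le_trans (by gcongr) hd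
    · have := weight_nonneg hp hq
      gcongr
      norm_num
  have cross : ∀ p ∈ Set.Icc (π / 2 - d / 2) (π / 2 + d / 2), ∀ q ∈ Set.Icc 0 d,
      |backflowKernel M p q| ≤ 4 * M * ((p / q) ^ ((1 : ℝ) / 4) + (q / p) ^ ((1 : ℝ) / 4)) := by
    intro p hp q hq
    have h := abs_backflowKernel_le_of_cross (s := p - π / 2) hM hMe hd
      (abs_le.mpr ⟨by linarith [hp.1], by linarith [hp.2]⟩) hq.1 hq.2
    rwa [add_sub_cancel] at h
  rintro ⟨p, q⟩ ⟨hp | hp, hq | hq⟩ <;> simp only [norm_eq_abs] at hp hq ⊢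
  · exact near p q hp.1 hq.1 (abs_le.mpr ⟨by linarith [hp.1, hq.2], by linarith [hp.2, hq.1]⟩)
  · rw [backflowKernel_comm, add_comm]
    exact cross q hq p hp
  · exact cross p hp q hq
  · exact near p q (by linarith [hp.1]) (by linarith [hq.1])
      (abs_le.mpr ⟨by linarith [hp.1, hq.2], by linarith [hp.2, hq.1]⟩)

lemma setIntegral_backflowKernel_le_low (hM : 2 ≤ M) (hd0 : 0 < d) (hd : M * d ≤ π / 6)
    (hint : IntegrableOn (fun z : ℝ × ℝ => backflowKernel M z.1 z.2)
      (Set.Icc 0 d ×ˢ Set.Icc 0 d) (volume.prod volume)) :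
    ∫ z in Set.Icc 0 d ×ˢ Set.Icc 0 d, backflowKernel M z.1 z.2 ∂(volume.prod volume) ≤
      2 * M * (32 / 15 * d ^ 2) := by
  have hM' : (2 : ℝ) ≤ M := by exact_mod_cast hM
  have h1 := hasSetIntegral_rpow hd0.le (r := 1 / 4) (by norm_num)
  have h2 := hasSetIntegral_rpow hd0.le (r := -(1 / 4)) (by norm_num)
  have h := ((h1.prod_mul h2).add (h2.prod_mul h1)).const_mul (2 * M)
  have hval : d ^ ((1 / 4 : ℝ) + 1) / (1 / 4 + 1) * (d ^ (-(1 / 4 : ℝ) + 1) / (-(1 / 4) + 1)) +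
      d ^ (-(1 / 4 : ℝ) + 1) / (-(1 / 4) + 1) * (d ^ ((1 / 4 : ℝ) + 1) / (1 / 4 + 1)) =
      32 / 15 * d ^ 2 := by
    have : d ^ ((1 / 4 : ℝ) + 1) * d ^ (-(1 / 4 : ℝ) + 1) = d ^ 2 := by
      rw [← rpow_add hd0, ← rpow_natCast]; norm_num
    rw [← this]; ring
  rw [hval] at h
  rw [← h.2]
  refine setIntegral_mono_on hint h.1 (measurableSet_Icc.prod measurableSet_Icc) ?_
  rintro ⟨p, q⟩ ⟨hp, hq⟩
  simp only at hp hq ⊢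
  have h3 := (le_abs_self _).trans (abs_backflowKernel_le_of_near (M := M) (by linarith) hp.1 hq.1
    (le_trans (mul_le_mul_of_nonneg_left (abs_le.mpr ⟨by linarith [hp.1, hq.2],
      by linarith [hp.2, hq.1]⟩) (by linarith)) hd))
  rwa [rpow_div_eq hp.1 hq.1, rpow_div_eq hq.1 hp.1, mul_comm (q ^ ((1 : ℝ) / 4))] at h3

lemma rpow_add_rpow_inv_le {r : ℝ} (h1 : r ≤ 6 / 5) (h2 : 5 / 6 ≤ r) :
    r ^ ((1 : ℝ) / 4) + (r⁻¹) ^ ((1 : ℝ) / 4) ≤ 2003 / 1000 := by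
  have hr : 0 < r := by linarith
  rw [inv_rpow hr.le]
  have hx : 0 < r ^ ((1 : ℝ) / 4) := rpow_pos_of_pos hr _
  have hx4 : (r ^ ((1 : ℝ) / 4)) ^ 4 = r := by
    rw [← rpow_natCast, ← rpow_mul hr.le]; norm_num
  generalize r ^ ((1 : ℝ) / 4) = x at *
  have hx1 : x ≤ 21 / 20 :=
    le_of_pow_le_pow_left₀ (n := 4) (by norm_num) (by norm_num) (by rw [hx4]; linarith)
  have hx2 : 20 / 21 ≤ x :=
    le_of_pow_le_pow_left₀ (n := 4) (by norm_num) hx.le (by rw [hx4]; linarith)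
  rw [← sub_nonneg]
  have : 2003 / 1000 - (x + x⁻¹) = (2003 / 1000 * x - x ^ 2 - 1) / x := by
    field_simp
    ring
  rw [this]
  apply div_nonneg _ hx.le
  nlinarith

lemma setIntegral_backflowKernel_le_high (hM : 2 ≤ M) (hd0 : 0 < d) (hd : M * d ≤ π / 6)
    (hint : IntegrableOn (fun z : ℝ × ℝ => backflowKernel M z.1 z.2)
      (Set.Icc (π / 2 - d / 2) (π / 2 + d / 2) ×ˢ Set.Icc (π / 2 - d / 2) (π / 2 + d / 2))
      (volume.prod volume)) :
    ∫ z in Set.Icc (π / 2 - d / 2) (π / 2 + d / 2) ×ˢ Set.Icc (π / 2 - d / 2) (π / 2 + d / 2),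
      backflowKernel M z.1 z.2 ∂(volume.prod volume) ≤ 2 * M * (2003 / 1000 * d ^ 2) := by
  have hM' : (2 : ℝ) ≤ M := by exact_mod_cast hM
  have hd12 : d ≤ π / 12 := by nlinarith
  have h1 := hasSetIntegral_cubic (h := d / 2) (by linarith) (π / 2) 1 0 0 0
  have h := (h1.prod_mul h1).const_mul (2 * M * (2003 / 1000))
  calc _ ≤ _ := setIntegral_mono_on hint h.1 (measurableSet_Icc.prod measurableSet_Icc) ?_
    _ = _ := h.2
    _ = _ := by ring
  rintro ⟨p, q⟩ ⟨hp, hq⟩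
  simp only [zero_mul, add_zero, mul_one] at hp hq ⊢
  have hp0 : 0 < p := by linarith [hp.1, pi_pos]
  have hq0 : 0 < q := by linarith [hq.1, pi_pos]
  refine (le_abs_self _).trans ((abs_backflowKernel_le_of_near (M := M) (by linarith) hp0.le hq0.le
    (le_trans (mul_le_mul_of_nonneg_left (abs_le.mpr ⟨by linarith [hp.1, hq.2],
      by linarith [hp.2, hq.1]⟩) (by linarith)) hd)).trans ?_)
  gcongr
  rw [← inv_div p q]
  apply rpow_add_rpow_inv_le
  · rw [div_le_iff₀ hq0]; linarith [hp.2, hq.1]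
  · rw [le_div_iff₀ hq0]; linarith [hp.1, hq.2]

lemma ae_prod_ne_add (c : ℝ) : ∀ᵐ z : ℝ × ℝ ∂(volume.prod volume), z.1 - c ≠ z.2 := by
  rw [ae_iff]
  simp only [not_not]
  rw [Measure.measure_prod_null (measurableSet_eq_fun (by fun_prop) (by fun_prop))]
  refine Filter.Eventually.of_forall fun x => ?_
  have : Prod.mk x ⁻¹' {a : ℝ × ℝ | a.1 - c = a.2} = {x - c} := by
    ext y; simp [eq_comm]
  change volume (Prod.mk x ⁻¹' {a : ℝ × ℝ | a.1 - c = a.2}) = 0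
  rw [this, volume_singleton]

lemma setIntegral_backflowKernel_le_cross (hM : 2 ≤ M) (hMe : Even M) (hd0 : 0 < d)
    (hd : M * d ≤ π / 6)
    (hint : IntegrableOn (fun z : ℝ × ℝ => backflowKernel M z.1 z.2)
      (Set.Icc (π / 2 - d / 2) (π / 2 + d / 2) ×ˢ Set.Icc 0 d) (volume.prod volume)) :
    ∫ z in Set.Icc (π / 2 - d / 2) (π / 2 + d / 2) ×ˢ Set.Icc 0 d,
      backflowKernel M z.1 z.2 ∂(volume.prod volume) ≤
      -(2 * M * d * (124 / 100 * (2 * d / π) ^ (3 / 4 : ℝ) +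
        657 / 1000 * (2 * d / π) ^ (5 / 4 : ℝ))) := by
  have hM' : (2 : ℝ) ≤ M := by exact_mod_cast hM
  have hpi := pi_gt_three
  have hd12 : d ≤ π / 12 := by nlinarith
  obtain ⟨a, ha⟩ : ∃ a : ℝ, a = (2 * M) ^ 2 / 6 := ⟨_, rfl⟩
  obtain ⟨k, hk⟩ : ∃ k : ℝ, k = 3 / (2 * π) := ⟨_, rfl⟩
  obtain ⟨b, hb⟩ : ∃ b : ℝ, b = (π / 2) ^ (-(3 / 4) : ℝ) := ⟨_, rfl⟩
  obtain ⟨c, hc⟩ : ∃ c : ℝ, c = (π / 2) ^ (-(5 / 4) : ℝ) := ⟨_, rfl⟩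
  have hh : 0 ≤ d / 2 := by linarith
  have f := hasSetIntegral_cubic hh (π / 2)
  have g := fun (r : ℝ) (hr : -1 < r) => hasSetIntegral_rpow hd0.le hr
  have H := ((((((f 1 (-k) (-a) (a * k)).prod_mul (g (-(1 / 4)) (by norm_num))).add
    ((f 0 (2 * a) (-(2 * a * k)) 0).prod_mul (g (3 / 4) (by norm_num)))).add
    ((f (-a) (a * k) 0 0).prod_mul (g (7 / 4) (by norm_num)))).const_mul b).add
    (((((f 1 0 (-a) 0).prod_mul (g (1 / 4) (by norm_num))).add
    ((f 0 (2 * a) 0 0).prod_mul (g (5 / 4) (by norm_num)))).add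
    ((f (-a) 0 0 0).prod_mul (g (9 / 4) (by norm_num)))).const_mul (9 / 10 * c))).const_mul
      (-(2 * M))
  refine (setIntegral_mono_on_ae hint H.1 (measurableSet_Icc.prod measurableSet_Icc) ?_).trans ?_
  · filter_upwards [ae_prod_ne_add (π / 2)] with ⟨p, q⟩ hne ⟨hp, hq⟩
    simp only at hne hp hq ⊢
    rcases hq.1.eq_or_lt with rfl | hq0
    · simp [backflowKernel, zero_rpow]
    have h := neg_backflowKernel_ge_of_cross (s := p - π / 2) hM hMe hd
      (abs_le.mpr ⟨by linarith [hp.1], by linarith [hp.2]⟩) hq0 hq.2 hne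
    rw [add_sub_cancel, ← hb, ← hc, ← hk] at h
    have e1 : q ^ (3 / 4 : ℝ) = q ^ (-(1 / 4) : ℝ) * q := by
      rw [← rpow_add_one hq0.ne']; norm_num
    have e2 : q ^ (7 / 4 : ℝ) = q ^ (-(1 / 4) : ℝ) * q ^ 2 := by
      rw [← rpow_add_natCast hq0.ne']; norm_num
    have e3 : q ^ (5 / 4 : ℝ) = q ^ (1 / 4 : ℝ) * q := by
      rw [← rpow_add_one hq0.ne']; norm_num
    have e4 : q ^ (9 / 4 : ℝ) = q ^ (1 / 4 : ℝ) * q ^ 2 := by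
      rw [← rpow_add_natCast hq0.ne']; norm_num
    rw [e1, e2, e3, e4, ha]
    linarith
  · rw [H.2]
    have e1 : (2 * d / π) ^ (3 / 4 : ℝ) = b * d ^ (3 / 4 : ℝ) := by
      rw [hb, mul_comm 2 d, mul_div_assoc, ← inv_div π 2, ← div_eq_mul_inv,
        rpow_div_eq hd0.le (by positivity), mul_comm]
    have e2 : (2 * d / π) ^ (5 / 4 : ℝ) = c * d ^ (5 / 4 : ℝ) := by
      rw [hc, mul_comm 2 d, mul_div_assoc, ← inv_div π 2, ← div_eq_mul_inv,
        rpow_div_eq hd0.le (by positivity), mul_comm]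
    have n1 : -(1 / 4 : ℝ) + 1 = 3 / 4 := by norm_num
    have n4 : (1 / 4 : ℝ) + 1 = 5 / 4 := by norm_num
    have g2 : d ^ ((3 / 4 : ℝ) + 1) = d ^ (3 / 4 : ℝ) * d := rpow_add_one hd0.ne' _
    have g3 : d ^ ((7 / 4 : ℝ) + 1) = d ^ (3 / 4 : ℝ) * d ^ 2 := by
      rw [← rpow_add_natCast hd0.ne']; norm_num
    have g6 : d ^ ((9 / 4 : ℝ) + 1) = d ^ (5 / 4 : ℝ) * d ^ 2 := by
      rw [← rpow_add_natCast hd0.ne']; norm_num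
    rw [e1, e2, n1, n4, g2, g3, g6]
    have had : a * d ^ 2 ≤ 184 / 1000 := by
      have : (M * d) ^ 2 ≤ (3.1416 / 6) ^ 2 := by
        gcongr; linarith [pi_lt_d4]
      rw [ha]; nlinarith
    have ha0 : 0 ≤ a * d ^ 2 := by rw [ha]; positivity
    have hkd : k * d ≤ 1 / 8 := by
      rw [hk, div_mul_eq_mul_div, div_le_div_iff₀ (by positivity) (by norm_num)]; linarith
    have hX : 0 ≤ b * d ^ (3 / 4 : ℝ) := by rw [hb]; positivity
    have hY : 0 ≤ c * d ^ (5 / 4 : ℝ) := by rw [hc]; positivity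
    have hP : 124 / 100 ≤ 4 / 3 - (1 / 9 + 4 / 11) * (a * d ^ 2) -
        2 / 21 * ((a * d ^ 2) * (k * d)) := by nlinarith
    have hQ : 657 / 1000 ≤ 9 / 10 * (4 / 5 - (1 / 15 + 4 / 13) * (a * d ^ 2)) := by linarith
    have hR := mul_le_mul_of_nonneg_left (add_le_add (mul_le_mul_of_nonneg_right hP hX)
      (mul_le_mul_of_nonneg_right hQ hY)) (by positivity : 0 ≤ 2 * M * d)
    refine le_trans (le_of_eq ?_) (neg_le_neg hR)
    ring

end

lemma scalar_bound {y : ℝ} (hy0 : 0 ≤ y) (hy : y ≤ 16 / 25) :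
    4 / (3 * π) * (1 - 31 * π ^ 2 / 80 * y) ≤
      124 / 100 + 657 / 1000 * y ^ 2 - π / 4 * (32 / 15 + 2003 / 1000) * y := by
  have hpi := pi_gt_d4
  have hpi' := pi_lt_d4
  have h1 : 4 / (3 * π) * (1 - 31 * π ^ 2 / 80 * y) = 4 / (3 * π) - 31 / 60 * π * y := by
    field_simp
    ring
  have h2 : 4 / (3 * π) ≤ 425 / 1000 := by
    rw [div_le_iff₀ (by positivity)]; linarith
  rw [h1]
  nlinarith [mul_le_mul_of_nonneg_right hpi'.le hy0]

lemma leading_coeff_mul {m ε : ℝ} (hm : 0 < m) (hε : 0 < ε) :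
    2 ^ ((7 : ℝ) / 4) * ε ^ ((3 : ℝ) / 4) / (3 * π ^ ((11 : ℝ) / 4)) * m ^ ((1 : ℝ) / 4) *
      (2 * ε / (π * m)) ^ ((1 : ℝ) / 4) = 4 * ε / (3 * π ^ 3) := by
  have hpi := pi_pos
  rw [div_rpow (by positivity) (by positivity), mul_rpow (by positivity) (by positivity),
    mul_rpow (by positivity) (by positivity)]
  have h2 : (2 : ℝ) ^ ((7 : ℝ) / 4) * 2 ^ ((1 : ℝ) / 4) = 4 := by
    rw [← rpow_add two_pos]; norm_num
  have he : ε ^ ((3 : ℝ) / 4) * ε ^ ((1 : ℝ) / 4) = ε := by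
    rw [← rpow_add hε]; norm_num
  have hp : π ^ ((11 : ℝ) / 4) * π ^ ((1 : ℝ) / 4) = π ^ 3 := by
    rw [← rpow_add hpi, ← rpow_natCast]; norm_num
  have hm0 : m ^ ((1 : ℝ) / 4) ≠ 0 := (rpow_pos_of_pos hm _).ne'
  calc _ = 2 ^ ((7 : ℝ) / 4) * 2 ^ ((1 : ℝ) / 4) * (ε ^ ((3 : ℝ) / 4) * ε ^ ((1 : ℝ) / 4)) /
        (3 * (π ^ ((11 : ℝ) / 4) * π ^ ((1 : ℝ) / 4))) := by field_simp
    _ = _ := by rw [h2, he, hp]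

lemma bound_of_integral_le {m ε J : ℝ} (hm : 2 ≤ m) (hε : 0 < ε) (hε' : ε ≤ π / 6)
    (hJ : J ≤ 2 * m * ((32 / 15 + 2003 / 1000) * (ε / m) ^ 2) -
      2 * (2 * m * (ε / m) * (124 / 100 * (2 * (ε / m) / π) ^ (3 / 4 : ℝ) +
        657 / 1000 * (2 * (ε / m) / π) ^ (5 / 4 : ℝ)))) :
    2 ^ ((7 : ℝ) / 4) * ε ^ ((3 : ℝ) / 4) / (3 * π ^ ((11 : ℝ) / 4)) * m ^ ((1 : ℝ) / 4) *
        (1 - 31 * π ^ 2 / 80 * (2 * ε / (π * m)) ^ ((1 : ℝ) / 4)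
           - 5 / 8 * (2 * ε / (π * m))
           - 9 * π ^ 2 / 176 * (2 * ε / (π * m)) ^ ((5 : ℝ) / 4))
      ≤ -(m / (8 * π * ε)) * J := by
  have hpi := pi_pos
  have hm0 : 0 < m := by linarith
  have hL := leading_coeff_mul hm0 hε
  obtain ⟨η, hη⟩ : ∃ η : ℝ, η = 2 * ε / (π * m) := ⟨_, rfl⟩
  have hη' : 2 * (ε / m) / π = η := by rw [hη]; field_simp
  have hη0 : 0 < η := by rw [hη]; positivity
  have hη6 : η ≤ 1 / 6 := by
    rw [hη, div_le_iff₀ (by positivity)]; nlinarith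
  rw [hη'] at hJ
  rw [← hη] at hL ⊢
  obtain ⟨y, hy⟩ : ∃ y : ℝ, y = η ^ ((1 : ℝ) / 4) := ⟨_, rfl⟩
  have hy0 : 0 < y := by rw [hy]; positivity
  have hy4 : η = y ^ 4 := by
    rw [hy, ← rpow_natCast, ← rpow_mul hη0.le]; norm_num
  have e3 : η ^ ((3 : ℝ) / 4) = y ^ 3 := by
    rw [hy, ← rpow_natCast, ← rpow_mul hη0.le]; norm_num
  have e5 : η ^ ((5 : ℝ) / 4) = y ^ 5 := by
    rw [hy, ← rpow_natCast, ← rpow_mul hη0.le]; norm_num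
  have hy16 : y ≤ 16 / 25 :=
    le_of_pow_le_pow_left₀ (n := 4) (by norm_num) (by norm_num) (by rw [← hy4]; linarith)
  rw [← hy] at hL
  rw [e3, e5] at hJ
  rw [← hy, e5]
  generalize 2 ^ ((7 : ℝ) / 4) * ε ^ ((3 : ℝ) / 4) / (3 * π ^ ((11 : ℝ) / 4)) *
    m ^ ((1 : ℝ) / 4) = L at *
  have hL' : L = ε / (π ^ 2 * y) * (4 / (3 * π)) := by
    rw [eq_div_of_mul_eq hy0.ne' hL]; field_simp
  have hm' : m = 2 * ε / (π * y ^ 4) := by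
    rw [← hy4, hη]; field_simp
  have hS := scalar_bound hy0.le hy16
  calc L * (1 - 31 * π ^ 2 / 80 * y - 5 / 8 * η - 9 * π ^ 2 / 176 * y ^ 5)
      ≤ L * (1 - 31 * π ^ 2 / 80 * y) := by
        have hLpos : 0 ≤ L := by rw [hL']; positivity
        have h5 : 0 ≤ 9 * π ^ 2 / 176 * y ^ 5 := by positivity
        exact mul_le_mul_of_nonneg_left (by linarith) hLpos
    _ = ε / (π ^ 2 * y) * (4 / (3 * π) * (1 - 31 * π ^ 2 / 80 * y)) := by rw [hL']; ring
    _ ≤ ε / (π ^ 2 * y) *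
          (124 / 100 + 657 / 1000 * y ^ 2 - π / 4 * (32 / 15 + 2003 / 1000) * y) := by gcongr
    _ = -(m / (8 * π * ε)) * (2 * m * ((32 / 15 + 2003 / 1000) * (ε / m) ^ 2) -
          2 * (2 * m * (ε / m) * (124 / 100 * y ^ 3 + 657 / 1000 * y ^ 5))) := by
        rw [hm']
        field_simp
        ring
    _ ≤ _ := mul_le_mul_of_nonpos_left hJ (neg_nonpos.mpr (by positivity))

lemma setIntegral_union_prod_union {f : ℝ × ℝ → ℝ} {s t : Set ℝ} (hst : Disjoint s t)
    (hs : MeasurableSet s) (ht : MeasurableSet t)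
    (hf : IntegrableOn f ((s ∪ t) ×ˢ (s ∪ t)) (volume.prod volume))
    (hsymm : ∀ z, f z.swap = f z) :
    ∫ z in (s ∪ t) ×ˢ (s ∪ t), f z ∂(volume.prod volume) =
      (∫ z in s ×ˢ s, f z ∂(volume.prod volume)) + (∫ z in t ×ˢ t, f z ∂(volume.prod volume)) +
        2 * ∫ z in t ×ˢ s, f z ∂(volume.prod volume) := by
  have hl := Set.subset_union_left (s := s) (t := t)
  have hr := Set.subset_union_right (s := s) (t := t)
  have hsw : ∫ z in s ×ˢ t, f z ∂(volume.prod volume) =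
      ∫ z in t ×ˢ s, f z ∂(volume.prod volume) := by
    rw [← setIntegral_prod_swap]
    simp only [hsymm]
  rw [Set.union_prod, setIntegral_union (Set.disjoint_prod.mpr (Or.inl hst))
    (ht.prod (hs.union ht)) (hf.mono_set (Set.prod_mono hl le_rfl))
    (hf.mono_set (Set.prod_mono hr le_rfl)), Set.prod_union, Set.prod_union,
    setIntegral_union (Set.disjoint_prod.mpr (Or.inr hst)) (hs.prod ht)
    (hf.mono_set (Set.prod_mono hl hl)) (hf.mono_set (Set.prod_mono hl hr)),
    setIntegral_union (Set.disjoint_prod.mpr (Or.inr hst)) (ht.prod ht)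
    (hf.mono_set (Set.prod_mono hr hl)) (hf.mono_set (Set.prod_mono hr hr)), hsw]
  ring

/-- for even `M ≥ 2` and `ε ∈ (0, π/6]`, with `I₀ = [0, ε/M]` and
`I₁ = [π/2 − ε/(2M), π/2 + ε/(2M)]`,
`−(M/(8πε)) ∬_{(I₀∪I₁)²} [sin(2M(p−q))/((p−q)cos(p−q))]·[(p/q)^{1/4}+(q/p)^{1/4}]`
is at least `(2^{7/4} ε^{3/4}/(3π^{11/4})) · M^{1/4} · S(2ε/(πM))`, where
`S(η) = 1 − (31π²/80)η^{1/4} − (5/8)η − (9π²/176)η^{5/4}`. (The integrand is given the junk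
value `0` on the diagonal `p = q`, a Lebesgue-null set that does not affect the integral.) -/
theorem lower_bound_quadratic_form
    (M : ℕ) (hM : 2 ≤ M) (hMeven : Even M) (ε : ℝ) (hε : ε ∈ Set.Ioc 0 (π / 6)) :
    (2 ^ ((7:ℝ)/4) * ε ^ ((3:ℝ)/4) / (3 * π ^ ((11:ℝ)/4))) * (M:ℝ) ^ ((1:ℝ)/4) *
        (1 - (31 * π ^ 2 / 80) * (2 * ε / (π * (M:ℝ))) ^ ((1:ℝ)/4)
           - (5/8) * (2 * ε / (π * (M:ℝ)))
           - (9 * π ^ 2 / 176) * (2 * ε / (π * (M:ℝ))) ^ ((5:ℝ)/4))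
      ≤ -((M:ℝ) / (8 * π * ε)) *
        ∫ p in (Set.Icc (0:ℝ) (ε / M) ∪
            Set.Icc (π/2 - ε/(2*(M:ℝ))) (π/2 + ε/(2*(M:ℝ)))),
          ∫ q in (Set.Icc (0:ℝ) (ε / M) ∪
              Set.Icc (π/2 - ε/(2*(M:ℝ))) (π/2 + ε/(2*(M:ℝ)))),
            (Real.sin (2 * (M:ℝ) * (p - q)) / ((p - q) * Real.cos (p - q))) *
              ((p/q) ^ ((1:ℝ)/4) + (q/p) ^ ((1:ℝ)/4)) := by
  obtain ⟨hε0, hε6⟩ := hε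
  have hM' : (2 : ℝ) ≤ M := by exact_mod_cast hM
  have hM0 : (0 : ℝ) < M := by linarith
  have hd0 : 0 < ε / M := by positivity
  have hd : M * (ε / M) ≤ π / 6 := by rwa [mul_div_cancel₀ _ hM0.ne']
  have hhalf : ε / (2 * (M : ℝ)) = ε / M / 2 := by rw [div_div, mul_comm]
  have hd12 : ε / M ≤ π / 12 := by nlinarith
  have hint := integrableOn_backflowKernel hM hMeven hd0.le hd
  have hl := Set.subset_union_left (s := Set.Icc 0 (ε / M))
    (t := Set.Icc (π / 2 - ε / M / 2) (π / 2 + ε / M / 2))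
  have hr := Set.subset_union_right (s := Set.Icc 0 (ε / M))
    (t := Set.Icc (π / 2 - ε / M / 2) (π / 2 + ε / M / 2))
  have hdisj : Disjoint (Set.Icc 0 (ε / M)) (Set.Icc (π / 2 - ε / M / 2) (π / 2 + ε / M / 2)) :=
    Set.disjoint_left.mpr fun x h1 h2 => by linarith [h1.2, h2.1, pi_pos]
  apply bound_of_integral_le hM' hε0 hε6
  rw [hhalf]
  refine (setIntegral_prod (fun z : ℝ × ℝ => backflowKernel M z.1 z.2) hint).symm.trans_le ?_
  rw [setIntegral_union_prod_union hdisj measurableSet_Icc measurableSet_Icc hint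
    fun z => backflowKernel_comm _ _ _]
  have h00 := setIntegral_backflowKernel_le_low hM hd0 hd (hint.mono_set (Set.prod_mono hl hl))
  have h11 := setIntegral_backflowKernel_le_high hM hd0 hd (hint.mono_set (Set.prod_mono hr hr))
  have h10 := setIntegral_backflowKernel_le_cross hM hMeven hd0 hd
    (hint.mono_set (Set.prod_mono hr hl))
  linarith
end
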